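/- arXiv:1509.01165 — 5 statements merged into one kernel-verified Lean document; each statement's English description precedes it below -/
import Mathlib

section
/- Let D₁ ⊆ D₂ be division algebras, each finite dimensional over its center, with [D₂ : D₁] finite, and let d_i denote the degree of D_i (so dim_{Z_i} D_i = d_i², where Z_i is the center of D_i). Then d₂/d₁ is an integer that divides [D₂ : D₁]. -/
set_option synthInstance.maxHeartbeats 1000000
set_option maxHeartbeats 1000000
/-- Vectors on which a division ring `K` also acts from the right, through `K`-linear maps
agreeing with the left action on the `v i`, are linearly independent over `K` as soon as they
are so over the center of `K`. -/
theorem LinearIndependent.of_center {K M ι : Type*} [DivisionRing K] [AddCommGroup M]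
    [Module K M] {v : ι → M} (hφ : ∀ x : K, ∃ φ : M →ₗ[K] M, ∀ i, φ (v i) = x • v i)
    (hv : LinearIndependent (Subring.center K) v) : LinearIndependent K v := by
  classical
  rw [linearIndependent_iff'] at hv ⊢
  intro s
  induction s using Finset.induction_on with
  | empty => simp
  | insert a s ha ih =>
    intro g hg
    by_cases hga : g a = 0
    · rw [Finset.sum_insert ha, hga, zero_smul, zero_add] at hg
      intro i hi
      rcases Finset.mem_insert.1 hi with rfl | hi
      · exact hga
      · exact ih g hg i hi
    · exfalso
      let h : ι → K := fun i => (g a)⁻¹ * g i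
      have hha : h a = 1 := inv_mul_cancel₀ hga
      have hh : ∑ i ∈ insert a s, h i • v i = 0 := by
        simp only [h, mul_smul, ← Finset.smul_sum, hg, smul_zero]
      have comm : ∀ x : K, ∀ i ∈ s, h i * x - x * h i = 0 := by
        intro x
        apply ih
        obtain ⟨φ, hφ⟩ := hφ x
        have h1 : ∑ i ∈ insert a s, (h i * x) • v i = 0 := by
          have := congrArg φ hh
          simpa only [map_sum, map_smul, hφ, map_zero, smul_smul] using this
        have h2 : ∑ i ∈ insert a s, (x * h i) • v i = 0 := by
          simp only [mul_smul, ← Finset.smul_sum, hh, smul_zero]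
        have h3 : ∑ i ∈ insert a s, (h i * x - x * h i) • v i = 0 := by
          simp only [sub_smul, Finset.sum_sub_distrib, h1, h2, sub_zero]
        rwa [Finset.sum_insert ha, hha, one_mul, mul_one, sub_self, zero_smul, zero_add] at h3
      have hc : ∀ i ∈ insert a s, h i ∈ Subring.center K := by
        intro i hi
        rcases Finset.mem_insert.1 hi with rfl | hi
        · rw [hha]; exact one_mem _
        · exact Subring.mem_center_iff.2 fun x => (sub_eq_zero.1 (comm x i hi)).symm
      have := hv (insert a s) (fun i => if hi : i ∈ insert a s then ⟨h i, hc i hi⟩ else 0) (by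
        rw [← hh]
        refine Finset.sum_congr rfl fun i hi => ?_
        rw [dif_pos hi]
        rfl) a (Finset.mem_insert_self a s)
      rw [dif_pos (Finset.mem_insert_self a s)] at this
      exact one_ne_zero (hha.symm.trans (congrArg Subtype.val this))

namespace DivisionRing

section Sandwich

variable {K ι : Type*} [DivisionRing K] [Fintype ι]

/-- The linear map `x ↦ ∑ i, c i * x * b i` depends linearly on `c`. -/
def sandwich (b : ι → K) :
    (ι → K) →ₗ[Subring.center K] K →ₗ[Subring.center K] K where
  toFun c := ∑ i, LinearMap.mulLeftRight (Subring.center K) (c i, b i)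
  map_add' c c' := by
    ext x
    simp [add_mul, Finset.sum_add_distrib]
  map_smul' z c := by
    ext x
    simp [Finset.smul_sum]

theorem sandwich_apply (b c : ι → K) (x : K) : sandwich b c x = ∑ i, c i * x * b i := by
  simp [sandwich]

theorem sandwich_injective {b : ι → K} (hb : LinearIndependent (Subring.center K) b) :
    Function.Injective (sandwich b) := by
  rw [injective_iff_map_eq_zero]
  intro c hc
  have key : LinearIndependent K (fun (i : ι) (y : K) => y * b i) := by
    refine LinearIndependent.of_center (fun x => ?_) ?_
    · refine ⟨LinearMap.funLeft K K (fun y => x * y), fun i => ?_⟩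
      ext y
      simp [LinearMap.funLeft_apply, mul_assoc]
    · refine LinearIndependent.of_comp
        (LinearMap.proj (R := Subring.center K) (φ := fun _ : K => K) (1 : K)) ?_
      simpa [Function.comp_def] using hb
  funext i
  refine Fintype.linearIndependent_iff.1 key c ?_ i
  ext y
  have := LinearMap.congr_fun hc y
  rw [sandwich_apply] at this
  simpa [Finset.sum_apply, mul_assoc] using this

theorem sandwich_surjective [Module.Finite (Subring.center K) K]
    (b : Module.Basis ι (Subring.center K) K) : Function.Surjective (sandwich b) := by
  refine (LinearMap.injective_iff_surjective_of_finrank_eq_finrank ?_).1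
    (sandwich_injective b.linearIndependent)
  rw [Module.finrank_pi_fintype, Module.finrank_linearMap]
  simp [Module.finrank_eq_card_basis b]

end Sandwich

/-- A division ring of finite dimension over its center keeps its dimension under extension of
scalars to a field. -/
theorem finrank_eq_of_span_range_eq_top {K F R : Type*} [DivisionRing K]
    [Module.Finite (Subring.center K) K] [Field F] [Ring R] [Nontrivial R] [Algebra F R]
    (f : K →+* R) (hf : ∀ z : Subring.center K, ∃ c : F, algebraMap F R c = f z)
    (hspan : Submodule.span F (Set.range f) = ⊤) :
    Module.finrank F R = Module.finrank (Subring.center K) K := by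
  classical
  let b := Module.finBasis (Subring.center K) K
  have hli : LinearIndependent F (f ∘ b) := by
    rw [Fintype.linearIndependent_iff]
    intro g hg i
    obtain ⟨c, hc⟩ := sandwich_surjective b
      ((LinearMap.toSpanSingleton (Subring.center K) K 1).comp (b.coord i))
    have hcx : ∀ x, ∑ j, f (c j) * f x * f (b j) = f (b.repr x i : K) := by
      intro x
      have := congrArg f (LinearMap.congr_fun hc x)
      rw [sandwich_apply] at this
      simpa [Subring.smul_def] using this
    have h0 : ∑ j, f (c j) * (∑ k, g k • (f ∘ b) k) * f (b j) = 0 := by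
      rw [hg]
      simp
    have h1 : ∑ j, f (c j) * (∑ k, g k • (f ∘ b) k) * f (b j)
        = ∑ k, g k • ∑ j, f (c j) * f (b k) * f (b j) := by
      simp only [Finset.mul_sum, Finset.sum_mul, Finset.smul_sum, Function.comp_apply,
        mul_smul_comm, smul_mul_assoc]
      exact Finset.sum_comm
    rw [h1] at h0
    simp only [hcx] at h0
    rw [Finset.sum_eq_single i] at h0
    · simpa [Algebra.smul_def] using h0
    · intro k _ hk
      simp [Finsupp.single_eq_of_ne, hk.symm]
    · simp
  have hsp : ⊤ ≤ Submodule.span F (Set.range (f ∘ b)) := by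
    rw [← hspan, Submodule.span_le]
    rintro _ ⟨x, rfl⟩
    rw [← b.sum_repr x, map_sum]
    refine Submodule.sum_mem _ fun i _ => ?_
    obtain ⟨c, hc⟩ := hf (b.repr x i)
    rw [Subring.smul_def, smul_eq_mul, map_mul, ← hc, ← Algebra.smul_def]
    exact Submodule.smul_mem _ _ (Submodule.subset_span ⟨i, rfl⟩)
  rw [Module.finrank_eq_card_basis (Module.Basis.mk hli hsp), Fintype.card_fin]

section Centralizer

variable {D : Type*} [DivisionRing D] [Module.Finite (Subring.center D) D]

/-- The dimension of a division ring over a subalgebra `S` is the dimension of the centralizer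
of `S` over the center. -/
theorem finrank_eq_finrank_centralizer (S : Subalgebra (Subring.center D) D) :
    Module.finrank S D
      = Module.finrank (Subring.center D) (Subalgebra.centralizer (Subring.center D) (S : Set D)) := by
  classical
  let : DivisionRing S := divisionRingOfFiniteDimensional (Subring.center D) S
  have : Module.Finite S D := Module.Finite.of_restrictScalars_finite (Subring.center D) S D
  let E := Subalgebra.centralizer (Subring.center D) (S : Set D)
  let b := Module.finBasis (Subring.center D) D
  let β := Module.finBasis S D
  have e₁ := (β.constr (Subring.center D) (M' := D)).finrank_eq
  let A : (Fin (Module.finrank (Subring.center D) D) → E) →ₗ[Subring.center D]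
      D →ₗ[Subring.center D] D := sandwich b ∘ₗ E.val.toLinearMap.compLeft _
  let B : (D →ₗ[S] D) →ₗ[Subring.center D] D →ₗ[Subring.center D] D :=
    LinearMap.restrictScalarsₗ (Subring.center D) S D D (Subring.center D)
  have hA : Function.Injective A := by
    refine (sandwich_injective b.linearIndependent).comp fun c c' h => ?_
    funext i
    exact Subtype.ext (congrFun h i)
  have hB : Function.Injective B := LinearMap.restrictScalars_injective _
  have hAB : LinearMap.range A = LinearMap.range B := by
    apply le_antisymm
    · rintro _ ⟨c, rfl⟩
      refine ⟨{ toFun := A c, map_add' := map_add _, map_smul' := fun s x => ?_ }, rfl⟩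
      change sandwich b _ _ = _ • sandwich b _ _
      simp only [sandwich_apply, Finset.smul_sum]
      refine Finset.sum_congr rfl fun i _ => ?_
      have := (Subalgebra.mem_centralizer_iff _).1 (c i).2 s s.2
      change (c i : D) * (s * x) * b i = s * ((c i : D) * x * b i)
      simp only [← mul_assoc, this]
    · rintro _ ⟨φ, rfl⟩
      obtain ⟨c, hc⟩ := sandwich_surjective b (B φ)
      have hφ : ∀ x, ∑ i, c i * x * b i = φ x := fun x => by
        rw [← sandwich_apply, hc]
        rfl
      have hcE : ∀ i, c i ∈ E := by
        intro i
        rw [Subalgebra.mem_centralizer_iff]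
        intro s hs
        have h0 : sandwich b (fun i => s * c i - c i * s) = 0 := by
          ext x
          have h1 : φ (s * x) = s * φ x := φ.map_smul ⟨s, hs⟩ x
          rw [← hφ, ← hφ, Finset.mul_sum] at h1
          rw [sandwich_apply]
          simp only [sub_mul, Finset.sum_sub_distrib, LinearMap.zero_apply, sub_eq_zero]
          simp only [mul_assoc] at h1 ⊢
          exact h1.symm
        have := sandwich_injective b.linearIndependent (h0.trans (map_zero _).symm)
        exact sub_eq_zero.1 (congrFun this i)
      exact ⟨fun i => ⟨c i, hcE i⟩, hc⟩
  have h₁ := LinearMap.finrank_range_of_inj hA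
  have h₂ := LinearMap.finrank_range_of_inj hB
  rw [hAB, h₂, ← e₁, Module.finrank_pi_fintype, Module.finrank_pi_fintype] at h₁
  simp only [Finset.sum_const, Finset.card_univ, Fintype.card_fin, smul_eq_mul] at h₁
  rw [mul_comm] at h₁
  exact Nat.eq_of_mul_eq_mul_left Module.finrank_pos h₁

end Centralizer

end DivisionRing

/-- Lemma (divalg)(i): let `D₁ ⊆ D₂` be division algebras (encoded: `D₂` a division ring and
`D₁` an inverse-closed subring, hence a division subring), each finite dimensional over its
center, with `[D₂ : D₁]` finite.  If `dᵢ` is the degree of `Dᵢ`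
(so `dim_{Zᵢ} Dᵢ = dᵢ²`), then `d₂ / d₁` is an integer dividing `[D₂ : D₁]`:
there is `q` with `d₂ = d₁ * q` and `q ∣ [D₂ : D₁]`. -/
theorem stmt3 (D₂ : Type*) [DivisionRing D₂] (D₁ : Subring D₂)
    (hinv : ∀ x ∈ D₁, x⁻¹ ∈ D₁)
    (hfc1 : Module.Finite (Subring.center ↥D₁) ↥D₁)
    (hfc2 : Module.Finite (Subring.center D₂) D₂)
    (hf12 : Module.Finite ↥D₁ D₂)
    (d₁ d₂ : ℕ)
    (hd1 : Module.finrank (Subring.center ↥D₁) ↥D₁ = d₁ ^ 2)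
    (hd2 : Module.finrank (Subring.center D₂) D₂ = d₂ ^ 2) :
    ∃ q : ℕ, d₂ = d₁ * q ∧ q ∣ Module.finrank ↥D₁ D₂ := by
  classical
  let Z := Subring.center D₂
  let K₁ : DivisionRing D₁ :=
    { (inferInstance : Ring D₁), (inferInstance : Nontrivial D₁) with
      inv := fun x => ⟨(x : D₂)⁻¹, hinv x x.2⟩
      mul_inv_cancel := fun x hx =>
        Subtype.ext (mul_inv_cancel₀ fun h => hx (Subtype.ext h))
      inv_zero := Subtype.ext inv_zero
      nnqsmul := _
      nnqsmul_def := fun _ _ => rfl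
      qsmul := _
      qsmul_def := fun _ _ => rfl }
  let S : Subalgebra Z D₂ := Algebra.adjoin Z (D₁ : Set D₂)
  let E : Subalgebra Z D₂ := Subalgebra.centralizer Z (S : Set D₂)
  let F : Subalgebra Z S := Subalgebra.center Z S
  let KS : DivisionRing S := divisionRingOfFiniteDimensional Z S
  let KF : Field F := fieldOfFiniteDimensional Z F
  let AF : Algebra F S := Algebra.ofModule (fun c x y => mul_assoc (c : S) x y) fun c x y => by
    change x * ((c : S) * y) = c * (x * y)
    rw [← mul_assoc, Subalgebra.mem_center_iff.1 c.2 x, mul_assoc]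
  let f : D₁ →+* S :=
    D₁.subtype.codRestrict S.toSubring fun x => Algebra.subset_adjoin (R := Z) x.2
  let g : F →+* E := (S.val.comp F.val).toRingHom.codRestrict E.toSubring fun x => by
    refine (Subalgebra.mem_centralizer_iff Z).2 fun s hs => ?_
    exact congrArg Subtype.val (Subalgebra.mem_center_iff.1 x.2 ⟨s, hs⟩)
  let MS : Module D₁ S := Module.compHom S f
  let ME : Module F E := Module.compHom E g
  have towerS : IsScalarTower D₁ S D₂ := ⟨fun x y z => mul_assoc (x : D₂) (y : D₂) z⟩
  have towerE : IsScalarTower Z F E :=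
    ⟨fun x y z => Subtype.ext (mul_assoc (x : D₂) ((y : S) : D₂) (z : D₂))⟩
  have hS : Module.finrank F S = d₁ ^ 2 := by
    rw [← hd1]
    have hmul : Submodule.span Z (D₁ : Set D₂) = Subalgebra.toSubmodule S := by
      rw [Algebra.adjoin_eq_span]
      congr 1
      exact (congrArg SetLike.coe (Submonoid.closure_eq D₁.toSubmonoid)).symm
    have hcomm : ∀ z ∈ Subring.center D₁, ∀ s ∈ S, (s : D₂) * z = z * s := by
      intro z hz s hs
      have hs' : s ∈ Subalgebra.toSubmodule S := hs
      rw [← hmul] at hs'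
      induction hs' using Submodule.span_induction with
      | mem x hx => exact congrArg Subtype.val (Subring.mem_center_iff.1 hz ⟨x, hx⟩)
      | zero => simp
      | add x y hx hy h1 h2 =>
        rw [hmul] at hx hy
        rw [add_mul, mul_add, h1 hx, h2 hy]
      | smul a x hx h1 =>
        rw [hmul] at hx
        rw [smul_mul_assoc, mul_smul_comm, h1 hx]
    refine DivisionRing.finrank_eq_of_span_range_eq_top (F := F) f (fun z => ?_) ?_
    · exact ⟨⟨f z, Subalgebra.mem_center_iff.2 fun s =>
        Subtype.ext (hcomm z z.2 s s.2)⟩, mul_one _⟩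
    · rw [eq_top_iff]
      rintro ⟨s, hs⟩ -
      have hs' : s ∈ Subalgebra.toSubmodule S := hs
      rw [← hmul] at hs'
      induction hs' using Submodule.span_induction with
      | mem x hx => exact Submodule.subset_span ⟨⟨x, hx⟩, rfl⟩
      | zero => exact Submodule.zero_mem _
      | add x y hx hy h1 h2 =>
        rw [hmul] at hx hy
        exact Submodule.add_mem _ (h1 hx) (h2 hy)
      | smul a x hx h1 =>
        rw [hmul] at hx
        exact Submodule.smul_mem _ (algebraMap Z F a) (h1 hx)
  have t₁ : Module.finrank Z S * Module.finrank S D₂ = d₂ ^ 2 :=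
    (Module.finrank_mul_finrank Z S D₂).trans hd2
  have t₂ := Module.finrank_mul_finrank Z F S
  have t₃ := Module.finrank_mul_finrank Z F E
  have t₄ := Module.finrank_mul_finrank D₁ S D₂
  have t₅ : Module.finrank S D₂ = Module.finrank Z E :=
    DivisionRing.finrank_eq_finrank_centralizer S
  have hd₁ : 0 < d₁ := by
    have : 0 < Module.finrank (Subring.center D₁) D₁ := Module.finrank_pos
    rw [hd1] at this
    exact Nat.pos_of_ne_zero fun h => by simp [h] at this
  have hf : 0 < Module.finrank Z F := Module.finrank_pos
  rw [← t₄, t₅, ← t₃]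
  rw [t₅, ← t₃, ← t₂, hS] at t₁
  generalize Module.finrank Z F = a at *
  generalize Module.finrank F E = s at *
  have hsq : d₂ ^ 2 = (d₁ * a) ^ 2 * s := by rw [← t₁]; ring
  obtain ⟨t, rfl⟩ := (Nat.pow_dvd_pow_iff two_ne_zero).1 (Dvd.intro s hsq.symm)
  have hs : s = t ^ 2 := by
    rw [mul_pow] at hsq
    exact (Nat.eq_of_mul_eq_mul_left (by positivity) hsq).symm
  refine ⟨a * t, mul_assoc _ _ _, Dvd.dvd.mul_left ?_ _⟩
  rw [hs, pow_two]
  exact mul_dvd_mul_left a (Dvd.intro t rfl)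
end

section
/- Let D₁ ⊆ D₂ be division algebras, each finite dimensional over its center, with [D₂ : D₁] finite, and suppose their degrees are equal: d₁ = d₂. Then D₂ = Z₂·D₁, where Z₂ is the center of D₂, and the multiplication map induces an isomorphism Z₂ ⊗_{Z₁} D₁ ≅ D₂. -/
set_option synthInstance.maxHeartbeats 1000000
set_option maxHeartbeats 1000000

open scoped TensorProduct

/-- The ring homomorphism `Z₁ → Z₂` between the centers, given the inclusion of
the center of a (division) subring `D₁` into the center of `D₂`. -/
def centerInc {D₂ : Type*} [Ring D₂] (D₁ : Subring D₂)
    (h : ∀ x : Subring.center ↥D₁, (x : D₂) ∈ Subring.center D₂) :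
    Subring.center ↥D₁ →+* Subring.center D₂ where
  toFun x := ⟨((x : ↥D₁) : D₂), h x⟩
  map_one' := rfl
  map_mul' _ _ := rfl
  map_zero' := rfl
  map_add' _ _ := rfl

/-- A family commuting with a division subring `D₁` that is linearly independent over the
center of `D₁` is linearly independent over `D₁`. -/
theorem linearIndependent_of_commute {D : Type*} [DivisionRing D] (D₁ : Subring D)
    (hinv : ∀ x ∈ D₁, x⁻¹ ∈ D₁) {ι : Type*} (e : ι → D) (he : ∀ i, ∀ a ∈ D₁, a * e i = e i * a)
    (hli : LinearIndependent (Subring.center ↥D₁) e) : LinearIndependent ↥D₁ e := by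
  classical
  rw [linearIndependent_iff'] at hli ⊢
  intro s
  induction s using Finset.induction_on with
  | empty => simp
  | insert k s hk ih =>
    intro g hg
    have hgk : g k = 0 := by
      by_contra hne
      let v : ↥D₁ := ⟨((g k : ↥D₁) : D)⁻¹, hinv _ (g k).2⟩
      have hv : v * g k = 1 := Subtype.ext (inv_mul_cancel₀ fun h => hne (Subtype.ext h))
      have hsum : e k + ∑ i ∈ s, (v * g i) • e i = 0 := by
        have := congrArg (v • ·) hg
        simpa [Finset.sum_insert hk, smul_add, Finset.smul_sum, smul_smul, hv] using this
      have hcent : ∀ i ∈ s, ∀ a : ↥D₁, a * (v * g i) - v * g i * a = 0 := by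
        intro i hi a
        refine ih (fun i => a * (v * g i) - v * g i * a) ?_ i hi
        have h1 : (a : D) * (e k + ∑ i ∈ s, (v * g i) • e i) -
            (e k + ∑ i ∈ s, (v * g i) • e i) * a = 0 := by rw [hsum]; simp
        rw [mul_add, add_mul, he k a a.2, add_sub_add_left_eq_sub, Finset.mul_sum,
          Finset.sum_mul, ← Finset.sum_sub_distrib] at h1
        rw [← h1]
        refine Finset.sum_congr rfl fun j _ => ?_
        simp only [Subring.smul_def, Subring.coe_mul, AddSubgroupClass.coe_sub, smul_eq_mul,
          sub_mul, mul_assoc, he j a a.2]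
      let w : ι → Subring.center ↥D₁ := fun i =>
        if hi : i ∈ s then
          ⟨v * g i, Subring.mem_center_iff.2 fun a => sub_eq_zero.1 (hcent i hi a)⟩
        else 1
      have hw : ∑ i ∈ insert k s, w i • e i = 0 := by
        rw [Finset.sum_insert hk, ← hsum]
        congr 1
        · simp [w, hk]
        · refine Finset.sum_congr rfl fun i hi => ?_
          simp only [w, dif_pos hi]
          rfl
      have := hli _ w hw k (Finset.mem_insert_self k s)
      simp [w, hk] at this
    rw [Finset.sum_insert hk, hgk, zero_smul, zero_add] at hg
    intro i hi
    rcases Finset.mem_insert.1 hi with rfl | hi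
    · exact hgk
    · exact ih g hg i hi

/-- The elements of `D` commuting with `D₁`, as a module over the center of `D₁`. -/
def centralizerSubmodule {D : Type*} [Ring D] (D₁ : Subring D) :
    Submodule (Subring.center ↥D₁) D where
  carrier := {x | ∀ a ∈ D₁, a * x = x * a}
  add_mem' hx hy a ha := by rw [mul_add, add_mul, hx a ha, hy a ha]
  zero_mem' a _ := by simp
  smul_mem' z x hx a ha := by
    have hz : a * ((z : ↥D₁) : D) = (z : ↥D₁) * a :=
      congrArg Subtype.val (Subring.mem_center_iff.1 z.2 ⟨a, ha⟩)
    change a * (((z : ↥D₁) : D) * x) = ((z : ↥D₁) : D) * x * a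
    rw [← mul_assoc, hz, mul_assoc, hx a ha, mul_assoc]

/-- Elements of a division subring `D₁` that are linearly independent over its center satisfy no
linear relation with coefficients in the centralizer of `D₁`. -/
theorem eq_zero_of_sum_mul_eq_zero {D : Type*} [DivisionRing D] (D₁ : Subring D)
    (hinv : ∀ x ∈ D₁, x⁻¹ ∈ D₁) {ι : Type*} [Fintype ι] (b : ι → ↥D₁)
    (hb : LinearIndependent (Subring.center ↥D₁) b) (c : ι → D)
    (hc : ∀ i, ∀ a ∈ D₁, a * c i = c i * a) (hsum : ∑ i, c i * (b i : D) = 0) (i : ι) :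
    c i = 0 := by
  classical
  let _ : Field (Subring.center ↥D₁) :=
    { (inferInstance : CommRing (Subring.center ↥D₁)) with
      inv := fun z => ⟨⟨((z : ↥D₁) : D)⁻¹, hinv _ (z : ↥D₁).2⟩,
        Subring.mem_center_iff.2 fun a => Subtype.ext (by
          have hz : Commute (a : D) ((z : ↥D₁) : D) :=
            congrArg Subtype.val (Subring.mem_center_iff.1 z.2 a)
          exact hz.inv_right₀)⟩
      exists_pair_ne := ⟨0, 1, fun h => zero_ne_one (α := D)
        (congrArg (fun z : Subring.center ↥D₁ => ((z : ↥D₁) : D)) h)⟩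
      mul_inv_cancel := fun z hz => Subtype.ext (Subtype.ext
        (mul_inv_cancel₀ fun h => hz (Subtype.ext (Subtype.ext h))))
      inv_zero := Subtype.ext (Subtype.ext inv_zero)
      nnqsmul := _
      nnqsmul_def := fun _ _ => rfl
      qsmul := _
      qsmul_def := fun _ _ => rfl }
  let e := Module.Basis.ofVectorSpace (Subring.center ↥D₁) (centralizerSubmodule D₁)
  have heli : LinearIndependent ↥D₁ (fun j => (e j : D)) :=
    linearIndependent_of_commute D₁ hinv _ (fun j => (e j).2)
      (e.linearIndependent.map' (centralizerSubmodule D₁).subtype (Submodule.ker_subtype _))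
  let C : ι → centralizerSubmodule D₁ := fun i => ⟨c i, hc i⟩
  have hC : ∀ (s : Finset _) (i : ι), (e.repr (C i)).support ⊆ s →
      c i = ∑ j ∈ s, e.repr (C i) j • (e j : D) := by
    intro s i hs
    have := congrArg Subtype.val (e.linearCombination_repr (C i))
    rw [Finsupp.linearCombination_apply, Finsupp.sum_of_support_subset _ hs _ (by simp)] at this
    simpa [C] using this.symm
  let s := Finset.univ.biUnion fun i => (e.repr (C i)).support
  have hs : ∀ i, (e.repr (C i)).support ⊆ s := fun i =>
    Finset.subset_biUnion_of_mem (fun i => (e.repr (C i)).support) (Finset.mem_univ i)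
  have hrel : ∑ j ∈ s, (∑ i, e.repr (C i) j • b i) • (e j : D) = 0 := by
    rw [← hsum]
    simp_rw [Finset.sum_smul]
    rw [Finset.sum_comm]
    refine Finset.sum_congr rfl fun i _ => ?_
    rw [hC s i (hs i), Finset.sum_mul]
    refine Finset.sum_congr rfl fun j _ => ?_
    change ((e.repr (C i) j : ↥D₁) : D) * (b i : D) * (e j : D) =
      ((e.repr (C i) j : ↥D₁) : D) * (e j : D) * (b i : D)
    rw [mul_assoc, mul_assoc, (e j).2 _ (b i).2]
  have hzero : ∀ j ∈ s, e.repr (C i) j = 0 := fun j hj =>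
    Fintype.linearIndependent_iff.1 hb _ (linearIndependent_iff'.1 heli s _ hrel j hj) i
  rw [hC s i (hs i)]
  exact Finset.sum_eq_zero fun j hj => by rw [hzero j hj, zero_smul]

/-- If an `R`-basis of `A` is mapped to an `S`-basis of `B`, then `S ⊗[R] A ≃ B`. -/
theorem exists_tensorProduct_equiv {R S A B ι : Type*} [CommRing R] [CommRing S] [Ring A] [Ring B]
    [Algebra R S] [Algebra R A] [Algebra S B] [Algebra R B] [IsScalarTower R S B]
    (g : A →ₐ[R] B) (b : Module.Basis ι R A) (b' : Module.Basis ι S B)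
    (h : ∀ i, b' i = g (b i)) :
    ∃ e : (S ⊗[R] A) ≃+* B, ∀ s a, e (s ⊗ₜ a) = algebraMap S B s * g a := by
  let f : (S ⊗[R] A) →ₐ[S] B :=
    Algebra.TensorProduct.lift (Algebra.ofId S B) g fun s a => Algebra.commutes s (g a)
  have hf_tmul : ∀ s a, f (s ⊗ₜ a) = algebraMap S B s * g a := fun s a =>
    Algebra.TensorProduct.lift_tmul ..
  have hf : f.toLinearMap = ((b.baseChange S).equiv b' (Equiv.refl ι)).toLinearMap :=
    (b.baseChange S).ext fun i => by
      rw [Module.Basis.baseChange_apply, AlgHom.toLinearMap_apply, hf_tmul, map_one, one_mul, ← h,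
        ← Module.Basis.baseChange_apply, LinearEquiv.coe_coe, Module.Basis.equiv_apply,
        Equiv.refl_apply]
  have hbij : Function.Bijective f := by
    have : (f : S ⊗[R] A → B) = (b.baseChange S).equiv b' (Equiv.refl ι) :=
      congrArg DFunLike.coe hf
    rw [this]
    exact LinearEquiv.bijective _
  exact ⟨RingEquiv.ofBijective f hbij, hf_tmul⟩

/-- Lemma (divalg)(ii): let `D₁ ⊆ D₂` be division algebras, each finite dimensional over
its center, with `[D₂ : D₁]` finite, and suppose their degrees coincide (`d₁ = d₂ = d`).
Then `Z₁ ⊆ Z₂`, `D₂ = Z₂·D₁` (the subring generated by `Z₂` and `D₁` is all of `D₂`), and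
multiplication induces a ring isomorphism `Z₂ ⊗_{Z₁} D₁ ≃ D₂`. -/
theorem stmt4 (D₂ : Type*) [DivisionRing D₂] (D₁ : Subring D₂)
    (hinv : ∀ x ∈ D₁, x⁻¹ ∈ D₁)
    (hfc1 : Module.Finite (Subring.center ↥D₁) ↥D₁)
    (hfc2 : Module.Finite (Subring.center D₂) D₂)
    (hf12 : Module.Finite ↥D₁ D₂)
    (d : ℕ)
    (hd1 : Module.finrank (Subring.center ↥D₁) ↥D₁ = d ^ 2)
    (hd2 : Module.finrank (Subring.center D₂) D₂ = d ^ 2) :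
    Subring.closure ((Subring.center D₂ : Set D₂) ∪ (D₁ : Set D₂)) = ⊤ ∧
    ∃ h : ∀ x : Subring.center ↥D₁, (x : D₂) ∈ Subring.center D₂,
      letI : Algebra (Subring.center ↥D₁) (Subring.center D₂) := (centerInc D₁ h).toAlgebra
      ∃ e : ((Subring.center D₂) ⊗[Subring.center ↥D₁] ↥D₁) ≃+* D₂,
        ∀ (z : Subring.center D₂) (x : ↥D₁), e (z ⊗ₜ x) = (z : D₂) * (x : D₂) := by
  have hcomm : ∀ z : Subring.center D₂, ∀ a : D₂, a * z = z * a :=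
    fun z => Subring.mem_center_iff.1 z.2
  let _ : DivisionRing ↥D₁ := DivisionRing.ofIsUnitOrEqZero fun x => by
    by_cases hx : x = 0
    · exact Or.inr hx
    · have hx' : (x : D₂) ≠ 0 := fun h => hx (Subtype.ext h)
      exact Or.inl (IsUnit.of_mul_eq_one ⟨(x : D₂)⁻¹, hinv _ x.2⟩
        (Subtype.ext (mul_inv_cancel₀ hx')))
  let b : Module.Basis (Fin (d ^ 2)) (Subring.center ↥D₁) ↥D₁ := Module.finBasisOfFinrankEq _ _ hd1
  have hdpos : 0 < d ^ 2 := hd2 ▸ Module.finrank_pos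
  have hindep := eq_zero_of_sum_mul_eq_zero D₁ hinv b b.linearIndependent
  have hcentral : ∀ c : D₂, (∀ a ∈ D₁, a * c = c * a) → c ∈ Subring.center D₂ := by
    intro c hc
    by_contra hcZ
    have hli : LinearIndependent (Subring.center D₂)
        (Sum.elim (fun i => (b i : D₂)) fun i => c * (b i : D₂)) := by
      rw [Fintype.linearIndependent_iff]
      intro g hg
      have hrel : ∀ i, (g (.inl i) : D₂) + g (.inr i) * c = 0 := by
        refine hindep _ (fun i a ha => ?_) ?_
        · rw [mul_add, add_mul, hcomm, ← mul_assoc, hcomm, mul_assoc, hc a ha, mul_assoc]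
        · rw [← hg, Fintype.sum_sum_type, ← Finset.sum_add_distrib]
          refine Finset.sum_congr rfl fun i _ => ?_
          simp only [Sum.elim_inl, Sum.elim_inr, Subring.smul_def, smul_eq_mul, add_mul, mul_assoc]
      have hr : ∀ i, g (.inr i) = 0 := by
        intro i
        by_contra hne
        have hne' : (g (.inr i) : D₂) ≠ 0 := fun h => hne (Subtype.ext h)
        apply hcZ
        have : c = ((-(g (.inl i)) * (g (.inr i))⁻¹ : Subring.center D₂) : D₂) := by
          have h1 : (g (.inr i) : D₂) * c = -g (.inl i) := by
            rw [eq_neg_iff_add_eq_zero, add_comm]; exact hrel i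
          have h2 : c = (g (.inr i) : D₂)⁻¹ * -g (.inl i) := by
            rw [← h1, inv_mul_cancel_left₀ hne']
          rw [mul_comm]
          exact h2
        rw [this]
        exact Subtype.prop _
      rintro (i | i)
      · have := hrel i
        rw [hr i] at this
        exact Subtype.ext (by simpa using this)
      · exact hr i
    have := hli.fintype_card_le_finrank
    simp only [Fintype.card_sum, Fintype.card_fin, hd2] at this
    omega
  have h : ∀ x : Subring.center ↥D₁, (x : D₂) ∈ Subring.center D₂ := fun x =>
    hcentral _ fun a ha => congrArg Subtype.val (Subring.mem_center_iff.1 x.2 ⟨a, ha⟩)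
  have hli : LinearIndependent (Subring.center D₂) (fun i => (b i : D₂)) := by
    rw [Fintype.linearIndependent_iff]
    intro g hg i
    exact Subtype.ext (hindep (fun i => g i) (fun i a _ => hcomm _ a) hg i)
  have : Nonempty (Fin (d ^ 2)) := ⟨⟨0, hdpos⟩⟩
  let b' := basisOfLinearIndependentOfCardEqFinrank hli (by simp [hd2])
  let _ : Algebra (Subring.center ↥D₁) (Subring.center D₂) := (centerInc D₁ h).toAlgebra
  let _ : Algebra (Subring.center ↥D₁) D₂ :=
    Algebra.ofModule (fun r x y => mul_assoc _ x y) fun r x y => by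
      change x * (((r : ↥D₁) : D₂) * y) = ((r : ↥D₁) : D₂) * (x * y)
      rw [← mul_assoc, hcomm ⟨_, h r⟩ x, mul_assoc]
  have : IsScalarTower (Subring.center ↥D₁) (Subring.center D₂) D₂ :=
    ⟨fun r s x => mul_assoc ((r : ↥D₁) : D₂) (s : D₂) x⟩
  let g : ↥D₁ →ₐ[Subring.center ↥D₁] D₂ :=
    { D₁.subtype with commutes' := fun r => (mul_one ((r : ↥D₁) : D₂)).symm }
  obtain ⟨e, he⟩ := exists_tensorProduct_equiv g b b' fun i =>
    congrFun (coe_basisOfLinearIndependentOfCardEqFinrank hli _) i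
  refine ⟨eq_top_iff.2 fun x _ => ?_, h, e, he⟩
  obtain ⟨t, rfl⟩ := e.surjective x
  induction t with
  | zero => rw [map_zero]; exact zero_mem _
  | tmul z a =>
    rw [he]
    exact mul_mem (Subring.subset_closure (Or.inl z.2)) (Subring.subset_closure (Or.inr a.2))
  | add x y hx hy => rw [map_add]; exact add_mem (hx trivial) (hy trivial)
end

section
/- Let H be a finite dimensional Hopf algebra over a field F acting on a field (commutative, as an F-algebra) Z, with dual coaction ρ : Z → Z ⊗ H*. Suppose the image B of the Galois map can : Z ⊗_{Z^H} Z → Z ⊗ H*, can(z ⊗ z') = (z ⊗ 1)ρ(z'), has the form Z ⊗ B₀ for some subalgebra B₀ ⊆ H*. Then B₀ is a subbialgebra of H*, hence a Hopf subalgebra of H*. -/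
open scoped TensorProduct

section Helpers

variable {F K : Type*} [Field F] [Ring K]

/-- The convolution product of two linear endomorphisms preserving a subalgebra `B` sends `b` into
`B` as soon as the comultiplication of `b` lies in `B ⊗ B`. -/
theorem convMul_mem_of_comul_mem [Bialgebra F K] {B : Subalgebra F K} {b : K}
    (hb : Coalgebra.comul (R := F) b ∈ LinearMap.range
      (TensorProduct.map (Subalgebra.toSubmodule B).subtype (Subalgebra.toSubmodule B).subtype))
    {f g : K →ₗ[F] K} (hf : ∀ x ∈ B, f x ∈ B) (hg : ∀ x ∈ B, g x ∈ B) :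
    (WithConv.toConv f * WithConv.toConv g) b ∈ B := by
  obtain ⟨t, ht⟩ := hb
  rw [LinearMap.convMul_apply, ← ht]
  clear ht
  induction t with
  | zero => simp
  | add x y hx hy => simpa only [map_add] using add_mem hx hy
  | tmul x y =>
    simpa using mul_mem (hf x x.2) (hg y y.2)

/-- A subbialgebra of a finite dimensional Hopf algebra is stable under the antipode. -/
theorem antipode_mem_of_comul_mem [HopfAlgebra F K] [FiniteDimensional F K] {B : Subalgebra F K}
    (hB : ∀ b ∈ B, Coalgebra.comul (R := F) b ∈ LinearMap.range
      (TensorProduct.map (Subalgebra.toSubmodule B).subtype (Subalgebra.toSubmodule B).subtype))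
    {b : K} (hb : b ∈ B) : HopfAlgebra.antipode F b ∈ B := by
  let A : Submodule F (WithConv (K →ₗ[F] K)) :=
    { carrier := {f | ∀ x ∈ B, f x ∈ B}
      add_mem' := fun hf hg x hx => add_mem (hf x hx) (hg x hx)
      zero_mem' := fun x _ => zero_mem B
      smul_mem' := fun c f hf x hx => B.smul_mem (hf x hx) c }
  have : FiniteDimensional F (WithConv (K →ₗ[F] K)) :=
    (WithConv.linearEquiv F (K →ₗ[F] K)).symm.finiteDimensional
  let i : WithConv (K →ₗ[F] K) := WithConv.toConv LinearMap.id
  let S : WithConv (K →ₗ[F] K) := WithConv.toConv (HopfAlgebra.antipode F)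
  have hSi : S * i = 1 := LinearMap.antipode_mul_id
  have hmul : ∀ f ∈ A, LinearMap.mulLeft F i f ∈ A := fun f hf x hx =>
    convMul_mem_of_comul_mem (hB x hx) (fun _ h => h) hf
  have hinj : Function.Injective ((LinearMap.mulLeft F i).restrict hmul) := by
    intro f g h
    have h' : i * f.1 = i * g.1 := congrArg Subtype.val h
    apply Subtype.ext
    rw [← one_mul f.1, ← one_mul g.1, ← hSi, mul_assoc, h', mul_assoc]
  have hone : (1 : WithConv (K →ₗ[F] K)) ∈ A := fun x _ => B.algebraMap_mem _
  obtain ⟨g, hg⟩ := LinearMap.injective_iff_surjective.mp hinj ⟨1, hone⟩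
  have hg' : i * g.1 = 1 := congrArg Subtype.val hg
  have hSg : S = g.1 := left_inv_eq_right_inv hSi hg'
  have hS : S ∈ A := hSg ▸ g.2
  exact hS b hb

end Helpers

/-- Lemma (fieldofdef), first part, in dual (comodule) form.  Let `K = H*` be a finite
dimensional Hopf algebra over a field `F`, and let `Z` be a field extension of `F` which is
a `K`-comodule algebra via `ρ : Z → Z ⊗ K` (the dual coaction of the `H`-action on `Z`).
Suppose the image `B` of the Galois map `can : Z ⊗_{Z^H} Z → Z ⊗ K`,
`can(z ⊗ z') = (z ⊗ 1)·ρ(z')`, i.e. the span of all such products, has the form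
`Z ⊗ B₀` for a subalgebra `B₀ ⊆ K`.  Then `B₀` is a subbialgebra of `K`
(`comul B₀ ⊆ B₀ ⊗ B₀`), hence a Hopf subalgebra (stable under the antipode). -/
theorem stmt11 (F : Type*) [Field F] (Z : Type*) [Field Z] [Algebra F Z]
    (K : Type*) [Ring K] [HopfAlgebra F K] [FiniteDimensional F K]
    (ρ : Z →ₐ[F] Z ⊗[F] K)
    (hcounit : ∀ z : Z, (TensorProduct.rid F Z)
      ((TensorProduct.map LinearMap.id (Coalgebra.counit (R := F))) (ρ z)) = z)
    (hcoassoc : ∀ z : Z,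
      (TensorProduct.map ρ.toLinearMap LinearMap.id) (ρ z) =
      (TensorProduct.assoc F Z K K).symm
        ((TensorProduct.map LinearMap.id (Coalgebra.comul (R := F))) (ρ z)))
    (B₀ : Subalgebra F K)
    (hB : Submodule.span F {w : Z ⊗[F] K | ∃ z z' : Z, w = (z ⊗ₜ[F] (1 : K)) * ρ z'} =
      LinearMap.range (TensorProduct.map (LinearMap.id : Z →ₗ[F] Z)
        (Subalgebra.toSubmodule B₀).subtype)) :
    (∀ b ∈ B₀, Coalgebra.comul (R := F) b ∈
      LinearMap.range (TensorProduct.map (Subalgebra.toSubmodule B₀).subtype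
        (Subalgebra.toSubmodule B₀).subtype)) ∧
    (∀ b ∈ B₀, HopfAlgebra.antipode (R := F) b ∈ B₀) := by
  let θ : (Z →ₗ[F] F) → Z ⊗[F] K →ₗ[F] K := fun ψ =>
    (TensorProduct.lid F K).toLinearMap ∘ₗ TensorProduct.map ψ LinearMap.id
  have hρ (z : Z) : ρ z ∈ LinearMap.range (TensorProduct.map (LinearMap.id : Z →ₗ[F] Z)
      (Subalgebra.toSubmodule B₀).subtype) := by
    rw [← hB]
    exact Submodule.subset_span ⟨1, z, by rw [← Algebra.TensorProduct.one_def, one_mul]⟩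
  have hθB (ψ : Z →ₗ[F] F) (z : Z) : θ ψ (ρ z) ∈ Subalgebra.toSubmodule B₀ := by
    obtain ⟨t, ht⟩ := hρ z
    rw [← ht]
    clear ht
    induction t with
    | zero => simp
    | add x y hx hy => simpa only [map_add] using add_mem hx hy
    | tmul x y => simpa [θ] using B₀.smul_mem y.2 (ψ x)
  have hassoc (ψ : Z →ₗ[F] F) (w : Z ⊗[F] K) : Coalgebra.comul (R := F) (θ ψ w) =
      TensorProduct.map (θ ψ) LinearMap.id ((TensorProduct.assoc F Z K K).symm
        (TensorProduct.map LinearMap.id (Coalgebra.comul (R := F)) w)) := by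
    induction w with
    | zero => simp
    | add x y hx hy => simp only [map_add, hx, hy]
    | tmul x y =>
      simp only [θ, LinearMap.comp_apply, TensorProduct.map_tmul, LinearMap.id_apply,
        LinearEquiv.coe_coe, TensorProduct.lid_tmul, map_smul]
      induction Coalgebra.comul (R := F) y with
      | zero => simp
      | add a b ha hb => simp only [smul_add, TensorProduct.tmul_add, map_add, ha, hb]
      | tmul a b => simp [TensorProduct.smul_tmul']
  have hcomul_coeff (ψ : Z →ₗ[F] F) (z : Z) : Coalgebra.comul (R := F) (θ ψ (ρ z)) ∈
      LinearMap.range (TensorProduct.map (Subalgebra.toSubmodule B₀).subtype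
        (Subalgebra.toSubmodule B₀).subtype) := by
    rw [hassoc, ← hcoassoc]
    obtain ⟨t, ht⟩ := hρ z
    rw [← ht]
    refine ⟨TensorProduct.map ((θ ψ ∘ₗ ρ.toLinearMap).codRestrict _ (hθB ψ)) LinearMap.id t, ?_⟩
    clear ht
    induction t with
    | zero => simp
    | add x y hx hy => simp only [map_add, hx, hy]
    | tmul x y => rfl
  have hmul (φ : Z →ₗ[F] F) (z : Z) (w : Z ⊗[F] K) :
      θ φ ((z ⊗ₜ[F] (1 : K)) * w) = θ (φ ∘ₗ LinearMap.mulLeft F z) w := by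
    induction w with
    | zero => simp
    | add x y hx hy => simp only [mul_add, map_add, hx, hy]
    | tmul x y => simp [θ]
  have hcomul : ∀ b ∈ B₀, Coalgebra.comul (R := F) b ∈
      LinearMap.range (TensorProduct.map (Subalgebra.toSubmodule B₀).subtype
        (Subalgebra.toSubmodule B₀).subtype) := by
    intro b hb
    obtain ⟨φ, hφ⟩ := Module.Projective.exists_dual_ne_zero F (one_ne_zero : (1 : Z) ≠ 0)
    have hspan : Submodule.span F {w : Z ⊗[F] K | ∃ z z' : Z, w = (z ⊗ₜ[F] (1 : K)) * ρ z'} ≤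
        (LinearMap.range (TensorProduct.map (Subalgebra.toSubmodule B₀).subtype
          (Subalgebra.toSubmodule B₀).subtype)).comap (Coalgebra.comul ∘ₗ θ φ) := by
      rw [Submodule.span_le]
      rintro _ ⟨z, z', rfl⟩
      rw [SetLike.mem_coe, Submodule.mem_comap, LinearMap.comp_apply, hmul]
      exact hcomul_coeff _ z'
    have hmem : ((φ 1)⁻¹ • (1 : Z)) ⊗ₜ[F] b ∈
        Submodule.span F {w : Z ⊗[F] K | ∃ z z' : Z, w = (z ⊗ₜ[F] (1 : K)) * ρ z'} := by
      rw [hB]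
      exact ⟨((φ 1)⁻¹ • (1 : Z)) ⊗ₜ ⟨b, hb⟩, by simp⟩
    have hθb : θ φ (((φ 1)⁻¹ • (1 : Z)) ⊗ₜ[F] b) = b := by
      simp only [θ, LinearMap.comp_apply, TensorProduct.map_tmul, LinearMap.id_apply,
        LinearEquiv.coe_coe, TensorProduct.lid_tmul, map_smul, smul_eq_mul]
      rw [inv_mul_cancel₀ hφ, one_smul]
    have := hspan hmem
    rwa [Submodule.mem_comap, LinearMap.comp_apply, hθb] at this
  exact ⟨hcomul, fun b hb => antipode_mem_of_comul_mem hcomul hb⟩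
end

section
/- Let W be the ring of Witt vectors of an algebraically closed field of characteristic p, W_m = W/(p^m), and let D_{p^m} be the localization of the Weyl algebra A_n(W_m) at the multiplicative set of elements that are not zero divisors (i.e., not in the ideal (p)). Then the associated graded ring of D_{p^m} with respect to the filtration by powers of p is isomorphic to D_p[z]/(z^m), where D_p is the division ring of fractions of A_n over the residue field; in particular D_{p^m} is an Artinian ring. -/
/-- The defining relations of the `n`-th Weyl algebra over `F`:
`x_i x_j = x_j x_i`, `y_i y_j = y_j y_i`, `y_i x_j = x_j y_i + δ_{ij}`. -/
inductive WeylRel (F : Type*) [CommRing F] (n : ℕ) :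
    FreeAlgebra F (Fin n ⊕ Fin n) → FreeAlgebra F (Fin n ⊕ Fin n) → Prop
  | xx (i j : Fin n) : WeylRel F n
      (FreeAlgebra.ι F (Sum.inl i) * FreeAlgebra.ι F (Sum.inl j))
      (FreeAlgebra.ι F (Sum.inl j) * FreeAlgebra.ι F (Sum.inl i))
  | yy (i j : Fin n) : WeylRel F n
      (FreeAlgebra.ι F (Sum.inr i) * FreeAlgebra.ι F (Sum.inr j))
      (FreeAlgebra.ι F (Sum.inr j) * FreeAlgebra.ι F (Sum.inr i))
  | yx (i j : Fin n) : WeylRel F n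
      (FreeAlgebra.ι F (Sum.inr i) * FreeAlgebra.ι F (Sum.inl j))
      (FreeAlgebra.ι F (Sum.inl j) * FreeAlgebra.ι F (Sum.inr i) + if i = j then 1 else 0)

/-- The `n`-th Weyl algebra `A_n(F)`. -/
def WeylAlgebra (F : Type*) [CommRing F] (n : ℕ) := RingQuot (WeylRel F n)

noncomputable instance (F : Type*) [CommRing F] (n : ℕ) : Ring (WeylAlgebra F n) :=
  inferInstanceAs (Ring (RingQuot (WeylRel F n)))

noncomputable instance (F : Type*) [CommRing F] (n : ℕ) : Algebra F (WeylAlgebra F n) :=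
  inferInstanceAs (Algebra F (RingQuot (WeylRel F n)))

/-- The generator `x_i` of the Weyl algebra. -/
noncomputable def WeylAlgebra.X {F : Type*} [CommRing F] {n : ℕ} (i : Fin n) : WeylAlgebra F n :=
  RingQuot.mkAlgHom F (WeylRel F n) (FreeAlgebra.ι F (Sum.inl i))

/-- The generator `y_i` of the Weyl algebra. -/
noncomputable def WeylAlgebra.Y {F : Type*} [CommRing F] {n : ℕ} (i : Fin n) : WeylAlgebra F n :=
  RingQuot.mkAlgHom F (WeylRel F n) (FreeAlgebra.ι F (Sum.inr i))

/-- The `m`-truncated Witt ring `W_{m,p} = W(k)/(p^m)`. -/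
def TruncWitt (p : ℕ) [Fact p.Prime] (k : Type*) [CommRing k] (m : ℕ) :=
  WittVector p k ⧸ Ideal.span {(p : WittVector p k) ^ m}

noncomputable instance (p : ℕ) [Fact p.Prime] (k : Type*) [CommRing k] (m : ℕ) :
    CommRing (TruncWitt p k m) :=
  inferInstanceAs (CommRing (WittVector p k ⧸ Ideal.span {(p : WittVector p k) ^ m}))

/-- The `i`-th graded piece `qⁱR / qⁱ⁺¹R` of the filtration of `R` by powers of `q`. -/
def grPiece (D : Type*) [Ring D] (q : D) (i : ℕ) : Type _ :=
  ↥(AddMonoidHom.mulLeft (q ^ i)).range ⧸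
    ((AddMonoidHom.mulLeft (q ^ (i + 1))).range.addSubgroupOf
      (AddMonoidHom.mulLeft (q ^ i)).range)

noncomputable instance (D : Type*) [Ring D] (q : D) (i : ℕ) : AddCommGroup (grPiece D q i) :=
  inferInstanceAs (AddCommGroup (_ ⧸ _))

/-- The class of `a ∈ qⁱR` in the graded piece `qⁱR/qⁱ⁺¹R`. -/
def grMk (D : Type*) [Ring D] (q : D) (i : ℕ) (a : D)
    (ha : a ∈ (AddMonoidHom.mulLeft (q ^ i)).range) : grPiece D q i :=
  QuotientAddGroup.mk ⟨a, ha⟩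

/-- The full localization of the Weyl algebra `A_n(F)` at the Ore set of
non-zero-divisors. -/
def WeylLoc (F : Type*) [CommRing F] (n : ℕ)
    [OreLocalization.OreSet (nonZeroDivisors (WeylAlgebra F n))] :=
  OreLocalization (nonZeroDivisors (WeylAlgebra F n)) (WeylAlgebra F n)

noncomputable instance (F : Type*) [CommRing F] (n : ℕ)
    [OreLocalization.OreSet (nonZeroDivisors (WeylAlgebra F n))] : Ring (WeylLoc F n) :=
  inferInstanceAs (Ring (OreLocalization (nonZeroDivisors (WeylAlgebra F n)) (WeylAlgebra F n)))

section GradedPieces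

variable {D E : Type*} [Ring D] [Ring E] {q : D} {φ : D →+* E} {m : ℕ}

/-- Multiplication by `q ^ i`, followed by the projection to the `i`-th graded piece. -/
def grMulPow (q : D) (i : ℕ) : D →+ grPiece D q i :=
  (QuotientAddGroup.mk' _).comp (AddMonoidHom.mulLeft (q ^ i)).rangeRestrict

theorem grMulPow_surjective (q : D) (i : ℕ) : Function.Surjective (grMulPow q i) :=
  (QuotientAddGroup.mk'_surjective _).comp (AddMonoidHom.rangeRestrict_surjective _)

theorem grMulPow_eq_zero_iff (q : D) (i : ℕ) (d : D) :
    grMulPow q i d = 0 ↔ ∃ y, q ^ (i + 1) * y = q ^ i * d := by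
  refine (QuotientAddGroup.eq_zero_iff
    ((AddMonoidHom.mulLeft (q ^ i)).rangeRestrict d)).trans ?_
  rw [AddSubgroup.mem_addSubgroupOf]
  rfl

theorem grMk_pow_mul (q : D) (i : ℕ) (d : D)
    (h : q ^ i * d ∈ (AddMonoidHom.mulLeft (q ^ i)).range) :
    grMk D q i (q ^ i * d) h = grMulPow q i d := rfl

theorem mul_mem_range_mulLeft_pow (hq : ∀ x, Commute q x) (i j : ℕ) (a b : D)
    (ha : a ∈ (AddMonoidHom.mulLeft (q ^ i)).range)
    (hb : b ∈ (AddMonoidHom.mulLeft (q ^ j)).range) :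
    a * b ∈ (AddMonoidHom.mulLeft (q ^ (i + j))).range := by
  obtain ⟨c, rfl⟩ := ha
  obtain ⟨d, rfl⟩ := hb
  refine ⟨c * d, ?_⟩
  simp only [AddMonoidHom.coe_mulLeft]
  rw [pow_add, mul_assoc, mul_assoc, ← mul_assoc (q ^ j), ((hq c).pow_left j).eq, mul_assoc]

theorem map_eq_zero_of_pow_mul_eq_zero (hann : ∀ x, q ^ (m - 1) * x = 0 → φ x = 0)
    {i : ℕ} (hi : i < m) {x : D} (hx : q ^ i * x = 0) : φ x = 0 := by
  refine hann x ?_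
  obtain ⟨j, hj⟩ := Nat.exists_eq_add_of_le (Nat.le_sub_one_of_lt hi)
  rw [hj, add_comm, pow_add, mul_assoc, hx, mul_zero]

theorem ker_grMulPow (hker : ∀ x, φ x = 0 ↔ q ∣ x)
    (hann : ∀ x, q ^ (m - 1) * x = 0 → φ x = 0) {i : ℕ} (hi : i < m) :
    (grMulPow q i).ker = (φ : D →+ E).ker := by
  ext d
  rw [AddMonoidHom.mem_ker, AddMonoidHom.mem_ker, grMulPow_eq_zero_iff]
  refine ⟨fun ⟨y, hy⟩ ↦ ?_, fun h ↦ ?_⟩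
  · have h0 : φ (d - q * y) = 0 := by
      refine map_eq_zero_of_pow_mul_eq_zero hann hi ?_
      rw [mul_sub, ← mul_assoc, ← pow_succ, hy, sub_self]
    rw [map_sub, (hker (q * y)).2 (Dvd.intro _ rfl), sub_zero] at h0
    exact h0
  · obtain ⟨y, rfl⟩ := (hker d).1 h
    exact ⟨y, by rw [pow_succ, mul_assoc]⟩

/-- If `φ : D → E` is onto with kernel `q D`, and `q ^ i x = 0` forces `x ∈ q D`, then
multiplication by `q ^ i` identifies `E` with the `i`-th graded piece of `D`. -/
noncomputable def grPieceEquiv (hφ : Function.Surjective φ) (hker : ∀ x, φ x = 0 ↔ q ∣ x)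
    (hann : ∀ x, q ^ (m - 1) * x = 0 → φ x = 0) (i : Fin m) : grPiece D q i ≃+ E :=
  (QuotientAddGroup.quotientKerEquivOfSurjective _ (grMulPow_surjective q i)).symm.trans
    ((QuotientAddGroup.quotientAddEquivOfEq (ker_grMulPow hker hann i.2)).trans
      (QuotientAddGroup.quotientKerEquivOfSurjective (φ : D →+ E) hφ))

theorem grPieceEquiv_grMulPow (hφ : Function.Surjective φ) (hker : ∀ x, φ x = 0 ↔ q ∣ x)
    (hann : ∀ x, q ^ (m - 1) * x = 0 → φ x = 0) (i : Fin m) (d : D) :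
    grPieceEquiv hφ hker hann i (grMulPow q i d) = φ d := by
  have h : (QuotientAddGroup.quotientKerEquivOfSurjective _ (grMulPow_surjective q i)).symm
      (grMulPow q i d) = (d : D ⧸ (grMulPow q (i : ℕ)).ker) :=
    (AddEquiv.symm_apply_eq _).2 rfl
  simp only [grPieceEquiv, AddEquiv.trans_apply, h]
  rfl

theorem grPieceEquiv_grMk_mul (hq : ∀ x, Commute q x) (hφ : Function.Surjective φ)
    (hker : ∀ x, φ x = 0 ↔ q ∣ x) (hann : ∀ x, q ^ (m - 1) * x = 0 → φ x = 0)
    (i j : Fin m) (h : (i : ℕ) + (j : ℕ) < m) (a b : D)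
    (ha : a ∈ (AddMonoidHom.mulLeft (q ^ (i : ℕ))).range)
    (hb : b ∈ (AddMonoidHom.mulLeft (q ^ (j : ℕ))).range)
    (hab : a * b ∈ (AddMonoidHom.mulLeft (q ^ ((i : ℕ) + (j : ℕ)))).range) :
    grPieceEquiv hφ hker hann ⟨(i : ℕ) + (j : ℕ), h⟩ (grMk D q ((i : ℕ) + (j : ℕ)) (a * b) hab) =
      grPieceEquiv hφ hker hann i (grMk D q i a ha) *
        grPieceEquiv hφ hker hann j (grMk D q j b hb) := by
  obtain ⟨c, rfl⟩ := ha
  obtain ⟨d, rfl⟩ := hb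
  have key : q ^ (i : ℕ) * c * (q ^ (j : ℕ) * d) = q ^ ((i : ℕ) + (j : ℕ)) * (c * d) := by
    rw [pow_add, mul_assoc, mul_assoc, ← mul_assoc (q ^ (j : ℕ)), ((hq c).pow_left j).eq,
      mul_assoc]
  simp only [AddMonoidHom.coe_mulLeft] at hab ⊢
  have hgr : grMk D q ((i : ℕ) + (j : ℕ)) (q ^ (i : ℕ) * c * (q ^ (j : ℕ) * d)) hab =
      grMulPow q ((i : ℕ) + (j : ℕ)) (c * d) := by
    simp only [key, grMk_pow_mul]
  rw [hgr, grMk_pow_mul, grMk_pow_mul]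
  refine (grPieceEquiv_grMulPow hφ hker hann ⟨(i : ℕ) + (j : ℕ), h⟩ (c * d)).trans ?_
  rw [grPieceEquiv_grMulPow, grPieceEquiv_grMulPow, map_mul]

theorem exists_eq_pow_mul_of_ne_zero (hnil : q ^ m = 0) {x : D} (hx : x ≠ 0) :
    ∃ j < m, ∃ u, x = q ^ j * u ∧ ¬ q ∣ u := by
  by_contra! hcon
  have hdvd : ∀ j ≤ m, q ^ j ∣ x := by
    intro j
    induction j with
    | zero => simp
    | succ j ih =>
      intro hj
      obtain ⟨u, rfl⟩ := ih (by omega)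
      obtain ⟨v, rfl⟩ := hcon j (by omega) u rfl
      exact ⟨v, by rw [pow_succ, mul_assoc]⟩
  obtain ⟨y, rfl⟩ := hdvd m le_rfl
  simp [hnil] at hx

/-- A ring in which every element outside `q D` is a unit, for a central nilpotent `q`, has only
the left ideals `D q ^ i`. -/
theorem isArtinianRing_of_isUnit_of_not_dvd (hq : ∀ x, Commute q x) (hnil : q ^ m = 0)
    (hunit : ∀ x, ¬ q ∣ x → IsUnit x) : IsArtinianRing D := by
  have hsurj : Function.Surjective fun i : Fin (m + 1) ↦ Ideal.span {q ^ (i : ℕ)} := by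
    classical
    intro I
    have hex : ∃ i, q ^ i ∈ I := ⟨m, by simp [hnil]⟩
    refine ⟨⟨Nat.find hex, Nat.lt_succ_of_le (Nat.find_min' hex (by simp [hnil]))⟩, ?_⟩
    refine le_antisymm ?_ fun x hx ↦ ?_
    · simpa [Ideal.span_singleton_le_iff_mem] using Nat.find_spec hex
    · rcases eq_or_ne x 0 with rfl | hx0
      · exact zero_mem _
      obtain ⟨j, -, u, rfl, hu⟩ := exists_eq_pow_mul_of_ne_zero hnil hx0
      rw [((hq u).pow_left j).eq] at hx ⊢
      obtain ⟨v, rfl⟩ := hunit u hu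
      have hj : q ^ j ∈ I := by simpa using I.mul_mem_left (↑v⁻¹ : D) hx
      obtain ⟨l, hl⟩ := Nat.exists_eq_add_of_le (Nat.find_min' hex hj)
      have hpow : q ^ j = q ^ l * q ^ Nat.find hex := by rw [← pow_add, add_comm, ← hl]
      rw [hpow, ← mul_assoc]
      exact Ideal.mul_mem_left _ _ (Ideal.subset_span rfl)
  have : Finite (Ideal D) := Finite.of_surjective _ hsurj
  exact Finite.to_wellFoundedLT

end GradedPieces

section Localization

open OreLocalization nonZeroDivisors

variable {A B : Type*} [Ring A] [Ring B] {p m : ℕ} {π : A →+* B}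

theorem mem_nonZeroDivisors_iff_map_ne_zero [NoZeroDivisors B] [Nontrivial B] (hm : 0 < m)
    (hker : ∀ x, π x = 0 ↔ (p : A) ∣ x) (hann : ∀ x, (p : A) ^ (m - 1) * x = 0 → π x = 0)
    (hnil : (p : A) ^ m = 0) (a : A) : a ∈ A⁰ ↔ π a ≠ 0 := by
  have hq : ∀ x : A, Commute (p : A) x := fun x ↦ Nat.cast_commute p x
  rw [mem_nonZeroDivisors_iff]
  refine ⟨fun ⟨h, _⟩ h0 ↦ ?_, fun ha ↦ ⟨fun x hx ↦ ?_, fun x hx ↦ ?_⟩⟩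
  · obtain ⟨b, rfl⟩ := (hker a).1 h0
    have h1 : (p : A) ^ (m - 1) = 0 := by
      refine h _ ?_
      rw [mul_assoc, ← ((hq b).pow_left _).eq, ← mul_assoc, ← pow_succ', Nat.sub_add_cancel hm,
        hnil, zero_mul]
    have h2 := hann 1 (by rw [h1, zero_mul])
    rw [map_one] at h2
    exact one_ne_zero h2
  · by_contra hx0
    obtain ⟨j, hj, u, rfl, hu⟩ := exists_eq_pow_mul_of_ne_zero hnil hx0
    rw [← mul_assoc, ← ((hq a).pow_left j).eq, mul_assoc] at hx
    have h := map_eq_zero_of_pow_mul_eq_zero hann hj hx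
    rw [map_mul, mul_eq_zero] at h
    exact h.elim ha fun h ↦ hu ((hker u).1 h)
  · by_contra hx0
    obtain ⟨j, hj, u, rfl, hu⟩ := exists_eq_pow_mul_of_ne_zero hnil hx0
    rw [mul_assoc] at hx
    have h := map_eq_zero_of_pow_mul_eq_zero hann hj hx
    rw [map_mul, mul_eq_zero] at h
    exact h.elim (fun h ↦ hu ((hker u).1 h)) ha

theorem OreLocalization.oreDiv_eq_numeratorUnit_inv_mul {S : Submonoid A} [OreSet S] (r : A)
    (s : S) : r /ₒ s = (↑(numeratorUnit s)⁻¹ : OreLocalization S A) * numeratorRingHom r := by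
  rw [Units.eq_inv_mul_iff_mul_eq]
  exact OreLocalization.mul_cancel

variable [OreSet A⁰]

theorem oreDiv_eq_zero_iff (r : A) (s : A⁰) : r /ₒ s = 0 ↔ r = 0 := by
  rw [oreDiv_eq_numeratorUnit_inv_mul, Units.mul_right_eq_zero]
  have h0 := map_zero (numeratorRingHom (R := A) (S := A⁰))
  exact ⟨fun h ↦ numeratorHom_inj (S := A⁰) inf_le_left (h.trans h0.symm), fun h ↦ h ▸ h0⟩

theorem natCast_pow_mul_oreDiv (p j : ℕ) (r : A) (s : A⁰) :
    (p : OreLocalization A⁰ A) ^ j * (r /ₒ s) = ((p : A) ^ j * r) /ₒ s := by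
  rw [oreDiv_eq_numeratorUnit_inv_mul, oreDiv_eq_numeratorUnit_inv_mul, map_mul, map_pow,
    map_natCast, ← mul_assoc, ← mul_assoc, ((Nat.cast_commute p _).pow_left j).eq]

theorem isArtinianRing_oreLocalization (hker : ∀ x, π x = 0 ↔ (p : A) ∣ x)
    (hreg : ∀ a, a ∈ A⁰ ↔ π a ≠ 0) (hnil : (p : A) ^ m = 0) :
    IsArtinianRing (OreLocalization A⁰ A) := by
  refine isArtinianRing_of_isUnit_of_not_dvd (q := (p : OreLocalization A⁰ A)) (m := m)
    (fun x ↦ Nat.cast_commute p x) ?_ fun x hx ↦ ?_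
  · rw [← map_natCast (numeratorRingHom (R := A) (S := A⁰)), ← map_pow, hnil, map_zero]
  · induction x with | _ r s
    have hr : r ∈ A⁰ := by
      rw [hreg, Ne, hker]
      rintro ⟨c, rfl⟩
      exact hx ⟨c /ₒ s, by simpa using (natCast_pow_mul_oreDiv p 1 c s).symm⟩
    rw [oreDiv_eq_numeratorUnit_inv_mul]
    exact (Units.isUnit _).mul (numerator_isUnit ⟨r, hr⟩)

variable [OreSet B⁰]

/-- The map on full localizations induced by a ring homomorphism preserving regular elements. -/
def oreMap (π : A →+* B) (hπ : ∀ a ∈ A⁰, π a ∈ B⁰) :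
    OreLocalization A⁰ A →+* OreLocalization B⁰ B :=
  universalHom (numeratorRingHom.comp π)
    { toFun := fun s ↦ numeratorUnit ⟨π s, hπ s s.2⟩
      map_one' := Units.ext (by
        change numeratorRingHom (π 1) = 1
        simp only [map_one])
      map_mul' := fun s t ↦ Units.ext (by
        change numeratorRingHom (π (s * t)) = numeratorRingHom (π s) * numeratorRingHom (π t)
        simp only [map_mul]) }
    fun _ ↦ rfl

theorem oreMap_oreDiv (hπ : ∀ a ∈ A⁰, π a ∈ B⁰) (r : A) (s : A⁰) :
    oreMap π hπ (r /ₒ s) = π r /ₒ ⟨π s, hπ s s.2⟩ := by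
  rw [oreDiv_eq_numeratorUnit_inv_mul (π r)]
  rfl

theorem oreMap_surjective (hπ : ∀ a ∈ A⁰, π a ∈ B⁰) (hπ' : ∀ a, π a ∈ B⁰ → a ∈ A⁰)
    (hsurj : Function.Surjective π) : Function.Surjective (oreMap π hπ) := by
  intro x
  induction x with | _ r s
  obtain ⟨r, rfl⟩ := hsurj r
  obtain ⟨s, hs⟩ := s
  obtain ⟨s, rfl⟩ := hsurj s
  exact ⟨r /ₒ ⟨s, hπ' s hs⟩, oreMap_oreDiv hπ r _⟩

theorem oreMap_eq_zero_iff (hπ : ∀ a ∈ A⁰, π a ∈ B⁰) (hker : ∀ x, π x = 0 ↔ (p : A) ∣ x)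
    (x : OreLocalization A⁰ A) : oreMap π hπ x = 0 ↔ (p : OreLocalization A⁰ A) ∣ x := by
  constructor
  · induction x with | _ r s
    rw [oreMap_oreDiv, oreDiv_eq_zero_iff, hker]
    rintro ⟨c, rfl⟩
    exact ⟨c /ₒ s, by simpa using (natCast_pow_mul_oreDiv p 1 c s).symm⟩
  · rintro ⟨y, rfl⟩
    have hp : π p = 0 := (hker _).2 dvd_rfl
    rw [map_natCast] at hp
    rw [map_mul, map_natCast, ← map_natCast (numeratorRingHom (R := B) (S := B⁰)), hp, map_zero,
      zero_mul]

theorem oreMap_eq_zero_of_pow_mul_eq_zero (hπ : ∀ a ∈ A⁰, π a ∈ B⁰)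
    (hann : ∀ x, (p : A) ^ (m - 1) * x = 0 → π x = 0) (x : OreLocalization A⁰ A)
    (hx : (p : OreLocalization A⁰ A) ^ (m - 1) * x = 0) : oreMap π hπ x = 0 := by
  induction x with | _ r s
  rw [natCast_pow_mul_oreDiv, oreDiv_eq_zero_iff] at hx
  rw [oreMap_oreDiv, oreDiv_eq_zero_iff]
  exact hann r hx

end Localization

namespace WeylAlgebra

open MvPolynomial

variable {R : Type*} [CommRing R] {n : ℕ}

@[elab_as_elim]
theorem induction {P : WeylAlgebra R n → Prop} (algebraMap : ∀ r, P (algebraMap R _ r))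
    (X : ∀ i, P (X i)) (Y : ∀ i, P (Y i)) (mul : ∀ a b, P a → P b → P (a * b))
    (add : ∀ a b, P a → P b → P (a + b)) (a : WeylAlgebra R n) : P a := by
  obtain ⟨a, rfl⟩ := RingQuot.mkAlgHom_surjective R (WeylRel R n) a
  induction a using FreeAlgebra.induction with
  | grade0 r => rw [AlgHom.commutes]; exact algebraMap r
  | grade1 i =>
    cases i with
    | inl i => exact X i
    | inr i => exact Y i
  | mul a b ha hb => rw [map_mul]; exact mul _ _ ha hb
  | add a b ha hb => rw [map_add]; exact add _ _ ha hb

theorem X_mul_X (i j : Fin n) : (X i * X j : WeylAlgebra R n) = X j * X i := by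
  have h := RingQuot.mkAlgHom_rel R (WeylRel.xx (F := R) i j)
  rw [map_mul, map_mul] at h
  exact h

theorem Y_mul_Y (i j : Fin n) : (Y i * Y j : WeylAlgebra R n) = Y j * Y i := by
  have h := RingQuot.mkAlgHom_rel R (WeylRel.yy (F := R) i j)
  rw [map_mul, map_mul] at h
  exact h

theorem Y_mul_X (i j : Fin n) :
    (Y i * X j : WeylAlgebra R n) = X j * Y i + if i = j then 1 else 0 := by
  have h := RingQuot.mkAlgHom_rel R (WeylRel.yx (F := R) i j)
  rw [map_mul, map_add, map_mul, apply_ite (RingQuot.mkAlgHom R (WeylRel R n)), map_one,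
    map_zero] at h
  exact h

section Lift

variable {C : Type*} [Ring C] [Algebra R C] (x y : Fin n → C)
  (hxx : ∀ i j, x i * x j = x j * x i) (hyy : ∀ i j, y i * y j = y j * y i)
  (hyx : ∀ i j, y i * x j = x j * y i + if i = j then 1 else 0)

/-- The universal property of the Weyl algebra. -/
noncomputable def lift : WeylAlgebra R n →ₐ[R] C :=
  RingQuot.liftAlgHom R ⟨FreeAlgebra.lift R (Sum.elim x y), by
    rintro _ _ (⟨i, j⟩ | ⟨i, j⟩ | ⟨i, j⟩)
    · simpa using hxx i j
    · simpa using hyy i j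
    · simpa [apply_ite (FreeAlgebra.lift R (Sum.elim x y))] using hyx i j⟩

theorem lift_X (i : Fin n) : lift x y hxx hyy hyx (X i : WeylAlgebra R n) = x i := by
  refine (RingQuot.liftAlgHom_mkAlgHom_apply R _ _ _).trans ?_
  simp

theorem lift_Y (i : Fin n) : lift x y hxx hyy hyx (Y i : WeylAlgebra R n) = y i := by
  refine (RingQuot.liftAlgHom_mkAlgHom_apply R _ _ _).trans ?_
  simp

end Lift

section Representation

theorem pderiv_comm {σ : Type*} (i j : σ) (f : MvPolynomial σ R) :
    pderiv i (pderiv j f) = pderiv j (pderiv i f) := by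
  classical
  have h : ⁅(pderiv i : Derivation R (MvPolynomial σ R) (MvPolynomial σ R)),
      (pderiv j : Derivation R (MvPolynomial σ R) (MvPolynomial σ R))⁆ = 0 := by
    refine MvPolynomial.derivation_ext fun l ↦ ?_
    simp [Derivation.commutator_apply, pderiv_X, Pi.single_apply, apply_ite]
  have := DFunLike.congr_fun h f
  rwa [Derivation.commutator_apply, Derivation.zero_apply, sub_eq_zero] at this

/-- The representation of the Weyl algebra on `R[x, y]` in which `X i` acts as `x i` and `Y i` as
`y i + ∂ / ∂ x i`. -/
noncomputable def rep (R : Type*) [CommRing R] (n : ℕ) :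
    WeylAlgebra R n →ₐ[R] Module.End R (MvPolynomial (Fin n ⊕ Fin n) R) :=
  lift (fun i ↦ LinearMap.mulLeft R (MvPolynomial.X (.inl i)))
    (fun i ↦ LinearMap.mulLeft R (MvPolynomial.X (.inr i)) + (pderiv (.inl i)).toLinearMap)
    (fun i j ↦ LinearMap.ext fun f ↦ by simp [mul_left_comm])
    (fun i j ↦ LinearMap.ext fun f ↦ by
      simp [mul_add, mul_left_comm, pderiv_comm (Sum.inl i) (Sum.inl j)]
      abel)
    (fun i j ↦ LinearMap.ext fun f ↦ by
      rcases eq_or_ne i j with rfl | hij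
      · simp [mul_add, mul_left_comm]; abel
      · simp [hij, pderiv_X_of_ne (Sum.inl_injective.ne hij.symm), mul_add, mul_left_comm])

theorem rep_X (i : Fin n) (f : MvPolynomial (Fin n ⊕ Fin n) R) :
    rep R n (X i) f = MvPolynomial.X (.inl i) * f := by
  rw [rep, lift_X]; rfl

theorem rep_Y (i : Fin n) (f : MvPolynomial (Fin n ⊕ Fin n) R) :
    rep R n (Y i) f = MvPolynomial.X (.inr i) * f + pderiv (.inl i) f := by
  rw [rep, lift_Y]; rfl

end Representation

section NormalForm

open scoped IsMulCommutative in
/-- Evaluation of a polynomial at a commuting family in a noncommutative algebra. -/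
noncomputable def commAeval {ι C : Type*} [Ring C] [Algebra R C] (x : ι → C)
    (h : ∀ i j, x i * x j = x j * x i) : MvPolynomial ι R →ₐ[R] C :=
  have : IsMulCommutative (Algebra.adjoin R (Set.range x)) :=
    Algebra.isMulCommutative_adjoin R (by rintro _ ⟨i, rfl⟩ _ ⟨j, rfl⟩; exact h i j)
  (Algebra.adjoin R (Set.range x)).val.comp
    (aeval fun i ↦ ⟨x i, Algebra.subset_adjoin (Set.mem_range_self i)⟩)

theorem commAeval_X {ι C : Type*} [Ring C] [Algebra R C] (x : ι → C)
    (h : ∀ i j, x i * x j = x j * x i) (i : ι) :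
    commAeval x h (MvPolynomial.X i : MvPolynomial ι R) = x i := by
  simp [commAeval]

/-- Polynomials in the `X i`. -/
noncomputable def polyX (R : Type*) [CommRing R] (n : ℕ) :
    MvPolynomial (Fin n) R →ₐ[R] WeylAlgebra R n := commAeval X X_mul_X

/-- Polynomials in the `Y i`. -/
noncomputable def polyY (R : Type*) [CommRing R] (n : ℕ) :
    MvPolynomial (Fin n) R →ₐ[R] WeylAlgebra R n := commAeval Y Y_mul_Y

theorem polyX_X (i : Fin n) : polyX R n (MvPolynomial.X i) = X i := commAeval_X _ _ i

theorem polyY_X (i : Fin n) : polyY R n (MvPolynomial.X i) = Y i := commAeval_X _ _ i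

theorem Y_mul_polyX (i : Fin n) (f : MvPolynomial (Fin n) R) :
    Y i * polyX R n f = polyX R n f * Y i + polyX R n (pderiv i f) := by
  induction f using MvPolynomial.induction_on with
  | C r =>
    rw [pderiv_C, map_zero, add_zero, ← MvPolynomial.algebraMap_eq, AlgHom.commutes]
    exact (Algebra.commutes r _).symm
  | add f g hf hg => simp only [map_add, mul_add, add_mul, hf, hg]; abel
  | mul_X f j hf =>
    rw [map_mul, ← mul_assoc, hf, add_mul, mul_assoc, polyX_X, Y_mul_X, pderiv_mul, map_add,
      map_mul, map_mul, polyX_X, pderiv_X, Pi.single_apply]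
    simp only [apply_ite (polyX R n), map_one, map_zero, eq_comm (a := j), mul_add, mul_assoc]
    abel

/-- The normally ordered element of the Weyl algebra attached to a polynomial in `x, y`. -/
noncomputable def normalOrder (R : Type*) [CommRing R] (n : ℕ) :
    MvPolynomial (Fin n ⊕ Fin n) R →ₗ[R] WeylAlgebra R n :=
  (TensorProduct.lift
    ((LinearMap.mul R (WeylAlgebra R n)).compl₁₂ (polyX R n).toLinearMap
      (polyY R n).toLinearMap)).comp
    (tensorEquivSum R (Fin n) (Fin n) R).symm.toLinearMap

theorem tensorEquivSum_tmul {σ ι : Type*} (f : MvPolynomial σ R) (g : MvPolynomial ι R) :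
    tensorEquivSum R σ ι R (f ⊗ₜ g) = rename .inl f * rename .inr g := by
  have h1 : (tensorEquivSum R σ ι R).toAlgHom.comp Algebra.TensorProduct.includeLeft =
      rename .inl := MvPolynomial.algHom_ext fun i ↦ by simp
  have h2 : (tensorEquivSum R σ ι R).toAlgHom.comp Algebra.TensorProduct.includeRight =
      rename .inr := MvPolynomial.algHom_ext fun i ↦ by simp
  rw [← h1, ← h2]
  simp [← map_mul]

theorem normalOrder_rename_mul_rename (f g : MvPolynomial (Fin n) R) :
    normalOrder R n (rename .inl f * rename .inr g) = polyX R n f * polyY R n g := by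
  rw [← tensorEquivSum_tmul]
  simp [normalOrder]

theorem exists_monomial_eq_rename_mul_rename {σ ι : Type*} (u : σ ⊕ ι →₀ ℕ) :
    ∃ s t, u.degree = s.degree + t.degree ∧ ∀ c : R, monomial u c =
      rename .inl (monomial s c) * rename .inr (monomial t 1) := by
  simp only [rename_monomial, monomial_mul, mul_one]
  suffices h : ∃ (s : σ →₀ ℕ) (t : ι →₀ ℕ), u = s.mapDomain .inl + t.mapDomain .inr by
    obtain ⟨s, t, rfl⟩ := h
    exact ⟨s, t, by simp [Finsupp.degree_mapDomain], fun _ ↦ rfl⟩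
  induction u using Finsupp.induction_linear with
  | zero => exact ⟨0, 0, by simp⟩
  | add u v hu hv =>
    obtain ⟨s, t, rfl⟩ := hu
    obtain ⟨s', t', rfl⟩ := hv
    exact ⟨s + s', t + t', by simp only [Finsupp.mapDomain_add]; abel⟩
  | single i k =>
    cases i with
    | inl i => exact ⟨.single i k, 0, by simp⟩
    | inr i => exact ⟨0, .single i k, by simp⟩

theorem induction_rename_mul_rename {σ ι : Type*} {P : MvPolynomial (σ ⊕ ι) R → Prop}
    (mul : ∀ f g, P (rename .inl f * rename .inr g)) (add : ∀ f g, P f → P g → P (f + g))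
    (f : MvPolynomial (σ ⊕ ι) R) : P f := by
  induction f using MvPolynomial.induction_on' with
  | monomial u c =>
    obtain ⟨s, t, -, h⟩ := exists_monomial_eq_rename_mul_rename (R := R) u
    rw [h]
    exact mul _ _
  | add f g hf hg => exact add f g hf hg

theorem normalOrder_rep (a : WeylAlgebra R n) (f : MvPolynomial (Fin n ⊕ Fin n) R) :
    normalOrder R n (rep R n a f) = a * normalOrder R n f := by
  induction a using WeylAlgebra.induction generalizing f with
  | algebraMap r => simp [Algebra.algebraMap_eq_smul_one]
  | mul a b ha hb => rw [map_mul, Module.End.mul_apply, ha, hb, mul_assoc]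
  | add a b ha hb => rw [map_add, LinearMap.add_apply, map_add, ha, hb, add_mul]
  | X i =>
    rw [rep_X]
    induction f using induction_rename_mul_rename with
    | add f g hf hg => rw [mul_add, map_add, hf, hg, map_add, mul_add]
    | mul f g =>
      rw [← mul_assoc, ← rename_X, ← map_mul, normalOrder_rename_mul_rename,
        normalOrder_rename_mul_rename, map_mul, polyX_X, mul_assoc]
  | Y i =>
    rw [rep_Y]
    induction f using induction_rename_mul_rename with
    | add f g hf hg =>
      rw [map_add (normalOrder R n) f g, mul_add (Y i), ← hf, ← hg,
        ← map_add (normalOrder R n), map_add (pderiv (R := R) (Sum.inl i)) f g,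
        mul_add (MvPolynomial.X (R := R) (Sum.inr i)) f g, add_add_add_comm]
    | mul f g =>
      have hg : pderiv (Sum.inl i) (rename (Sum.inr : Fin n → Fin n ⊕ Fin n) g) = 0 := by
        refine pderiv_eq_zero_of_notMem_vars fun h ↦ ?_
        classical
        simpa using vars_rename _ _ h
      rw [pderiv_mul, hg, mul_zero, add_zero, pderiv_rename Sum.inl_injective, mul_left_comm,
        ← rename_X Sum.inr, ← map_mul, map_add, normalOrder_rename_mul_rename,
        normalOrder_rename_mul_rename, normalOrder_rename_mul_rename, map_mul, polyY_X,
        ← mul_assoc, ← mul_assoc, Y_mul_polyX, add_mul]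

theorem normalOrder_rep_one (a : WeylAlgebra R n) : normalOrder R n (rep R n a 1) = a := by
  have h := normalOrder_rename_mul_rename (R := R) (n := n) 1 1
  simp only [map_one, mul_one] at h
  rw [normalOrder_rep, h, mul_one]

end NormalForm

section BaseChange

variable {S : Type*} [CommRing S] (f : R →+* S)

/-- The map of Weyl algebras induced by a homomorphism of coefficient rings. -/
noncomputable def map : WeylAlgebra R n →+* WeylAlgebra S n :=
  letI : Algebra R (WeylAlgebra S n) := Algebra.compHom _ f
  (lift X Y X_mul_X Y_mul_Y Y_mul_X : WeylAlgebra R n →ₐ[R] WeylAlgebra S n)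

theorem map_X (i : Fin n) : map f (X i) = X i :=
  letI : Algebra R (WeylAlgebra S n) := Algebra.compHom _ f
  lift_X X Y X_mul_X Y_mul_Y Y_mul_X i

theorem map_Y (i : Fin n) : map f (Y i) = Y i :=
  letI : Algebra R (WeylAlgebra S n) := Algebra.compHom _ f
  lift_Y X Y X_mul_X Y_mul_Y Y_mul_X i

theorem map_algebraMap (r : R) :
    map f (algebraMap R (WeylAlgebra R n) r) = algebraMap S (WeylAlgebra S n) (f r) :=
  letI : Algebra R (WeylAlgebra S n) := Algebra.compHom _ f
  (lift X Y X_mul_X Y_mul_Y Y_mul_X : WeylAlgebra R n →ₐ[R] WeylAlgebra S n).commutes r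

theorem map_surjective (hf : Function.Surjective f) :
    Function.Surjective (map f : WeylAlgebra R n →+* WeylAlgebra S n) := by
  intro a
  induction a using WeylAlgebra.induction with
  | algebraMap s =>
    obtain ⟨r, rfl⟩ := hf s
    exact ⟨_, map_algebraMap f r⟩
  | X i => exact ⟨_, map_X f i⟩
  | Y i => exact ⟨_, map_Y f i⟩
  | mul a b ha hb =>
    obtain ⟨a, rfl⟩ := ha
    obtain ⟨b, rfl⟩ := hb
    exact ⟨_, map_mul _ a b⟩
  | add a b ha hb =>
    obtain ⟨a, rfl⟩ := ha
    obtain ⟨b, rfl⟩ := hb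
    exact ⟨_, map_add _ a b⟩

theorem rep_map (a : WeylAlgebra R n) (g : MvPolynomial (Fin n ⊕ Fin n) R) :
    rep S n (map f a) (MvPolynomial.map f g) = MvPolynomial.map f (rep R n a g) := by
  induction a using WeylAlgebra.induction generalizing g with
  | algebraMap r =>
    rw [map_algebraMap, AlgHom.commutes, AlgHom.commutes, Module.algebraMap_end_apply,
      Module.algebraMap_end_apply, MvPolynomial.smul_eq_C_mul, MvPolynomial.smul_eq_C_mul, map_mul,
      MvPolynomial.map_C]
  | X i => rw [map_X, rep_X, rep_X, map_mul, MvPolynomial.map_X]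
  | Y i => rw [map_Y, rep_Y, rep_Y, map_add, map_mul, MvPolynomial.map_X, pderiv_map]
  | mul a b ha hb =>
    rw [map_mul, map_mul, map_mul, Module.End.mul_apply, Module.End.mul_apply, hb, ha]
  | add a b ha hb =>
    rw [map_add, map_add, map_add, LinearMap.add_apply, LinearMap.add_apply, map_add, hb, ha]

variable {f}

theorem dvd_of_C_dvd_rep_one (p : ℕ) {a : WeylAlgebra R n} (h : C (p : R) ∣ rep R n a 1) :
    (p : WeylAlgebra R n) ∣ a := by
  obtain ⟨g, hg⟩ := h
  refine ⟨normalOrder R n g, ?_⟩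
  rw [← normalOrder_rep_one a, hg, ← MvPolynomial.smul_eq_C_mul, map_smul, Algebra.smul_def,
    map_natCast]

theorem map_eq_zero_iff {p : ℕ} (hf : ∀ r, f r = 0 ↔ (p : R) ∣ r) (a : WeylAlgebra R n) :
    map f a = 0 ↔ (p : WeylAlgebra R n) ∣ a := by
  constructor
  · intro h
    refine dvd_of_C_dvd_rep_one p ((C_dvd_iff_dvd_coeff _ _).2 fun u ↦ (hf _).1 ?_)
    rw [← MvPolynomial.coeff_map, ← rep_map, h, map_zero, LinearMap.zero_apply, coeff_zero]
  · rintro ⟨b, rfl⟩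
    have hp : f p = 0 := (hf _).2 dvd_rfl
    rw [map_mul, ← map_natCast (algebraMap R (WeylAlgebra R n)), map_algebraMap, hp, map_zero,
      zero_mul]

theorem dvd_of_pow_mul_eq_zero {p l : ℕ} (hR : ∀ r : R, (p : R) ^ l * r = 0 → (p : R) ∣ r)
    {a : WeylAlgebra R n} (ha : (p : WeylAlgebra R n) ^ l * a = 0) :
    (p : WeylAlgebra R n) ∣ a := by
  refine dvd_of_C_dvd_rep_one p ((C_dvd_iff_dvd_coeff _ _).2 fun u ↦ hR _ ?_)
  have h : ((p : R) ^ l) • a = 0 := by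
    rw [Algebra.smul_def, map_pow, map_natCast, ha]
  rw [← smul_eq_mul, ← coeff_smul, ← LinearMap.smul_apply, ← map_smul, h, map_zero,
    LinearMap.zero_apply, coeff_zero]

end BaseChange

section Domain

/-- Polynomials all of whose monomials have total degree less than `d`. -/
def degreeLT (σ R : Type*) [CommRing R] (d : ℕ) : Submodule R (MvPolynomial σ R) where
  carrier := {f | ∀ u : σ →₀ ℕ, d ≤ u.degree → coeff u f = 0}
  zero_mem' _ _ := coeff_zero _
  add_mem' hf hg u hu := by rw [coeff_add, hf u hu, hg u hu, add_zero]
  smul_mem' c f hf u hu := by rw [coeff_smul, hf u hu, smul_zero]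

variable {σ : Type*}

theorem degreeLT_mono {d e : ℕ} (h : d ≤ e) : degreeLT σ R d ≤ degreeLT σ R e :=
  fun _ hf u hu ↦ hf u (h.trans hu)

theorem eq_zero_of_mem_degreeLT_zero {f : MvPolynomial σ R} (hf : f ∈ degreeLT σ R 0) : f = 0 :=
  MvPolynomial.ext _ _ fun u ↦ hf u (Nat.zero_le _)

theorem mul_mem_degreeLT {d e : ℕ} {f g : MvPolynomial σ R} (hf : f ∈ degreeLT σ R (d + 1))
    (hg : g ∈ degreeLT σ R e) : f * g ∈ degreeLT σ R (d + e) := by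
  classical
  intro u hu
  rw [coeff_mul]
  refine Finset.sum_eq_zero fun ⟨v, w⟩ hvw ↦ ?_
  rw [Finset.HasAntidiagonal.mem_antidiagonal] at hvw
  have hdeg : u.degree = v.degree + w.degree := by rw [← hvw, map_add]
  rcases le_or_gt (d + 1) v.degree with h | h
  · rw [hf v h, zero_mul]
  · rw [hg w (by omega), mul_zero]

theorem X_mem_degreeLT (i : σ) : (MvPolynomial.X i : MvPolynomial σ R) ∈ degreeLT σ R 2 := by
  classical
  intro u hu
  rw [coeff_X, if_neg]
  rintro rfl
  simp at hu

theorem C_mem_degreeLT (r : R) : (C r : MvPolynomial σ R) ∈ degreeLT σ R 1 := by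
  classical
  intro u hu
  rw [coeff_C, if_neg]
  rintro rfl
  simp at hu

theorem pderiv_mem_degreeLT {e : ℕ} {f : MvPolynomial σ R} (hf : f ∈ degreeLT σ R (e + 1))
    (i : σ) : pderiv i f ∈ degreeLT σ R e := by
  intro u hu
  rw [coeff_pderiv, hf, zero_mul]
  simpa using hu

/-- `f` is the symbol of order `d` of `a`: up to terms of lower degree, `a` acts on polynomials as
multiplication by `f`, which has degree at most `d`. -/
def IsSymbol (a : WeylAlgebra R n) (f : MvPolynomial (Fin n ⊕ Fin n) R) (d : ℕ) : Prop :=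
  f ∈ degreeLT _ R (d + 1) ∧
    ∀ e, ∀ g ∈ degreeLT _ R (e + 1), rep R n a g - f * g ∈ degreeLT _ R (d + e)

namespace IsSymbol

variable {a b : WeylAlgebra R n} {f g : MvPolynomial (Fin n ⊕ Fin n) R} {d e : ℕ}

theorem mono (ha : IsSymbol a f d) (h : d ≤ e) : IsSymbol a f e :=
  ⟨degreeLT_mono (by omega) ha.1, fun l g hg ↦ degreeLT_mono (by omega) (ha.2 l g hg)⟩

theorem add (ha : IsSymbol a f d) (hb : IsSymbol b g d) : IsSymbol (a + b) (f + g) d := by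
  refine ⟨add_mem ha.1 hb.1, fun l h hh ↦ ?_⟩
  convert add_mem (ha.2 l h hh) (hb.2 l h hh) using 1
  rw [map_add, LinearMap.add_apply]
  ring

theorem rep_sub_mul_mem (ha : IsSymbol a f d) {l : ℕ} {h : MvPolynomial (Fin n ⊕ Fin n) R}
    (hh : h ∈ degreeLT _ R l) : rep R n a h - f * h ∈ degreeLT _ R (d + l) := by
  cases l with
  | zero => simp [eq_zero_of_mem_degreeLT_zero hh]
  | succ l => exact degreeLT_mono (by omega) (ha.2 l h hh)

theorem mul (ha : IsSymbol a f d) (hb : IsSymbol b g e) : IsSymbol (a * b) (f * g) (d + e) := by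
  refine ⟨by simpa only [add_assoc] using mul_mem_degreeLT ha.1 hb.1, fun l h hh ↦ ?_⟩
  have hgh : g * h ∈ degreeLT _ R (e + (l + 1)) := mul_mem_degreeLT hb.1 hh
  have h1 := ha.2 (e + l) (g * h) hgh
  have h2 := ha.rep_sub_mul_mem (hb.2 l h hh)
  have h3 := mul_mem_degreeLT ha.1 (hb.2 l h hh)
  rw [add_assoc]
  convert add_mem (add_mem h1 h2) h3 using 1
  rw [map_mul, Module.End.mul_apply, map_sub]
  ring

theorem algebraMap (r : R) : IsSymbol (algebraMap R (WeylAlgebra R n) r) (C r) 0 := by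
  refine ⟨C_mem_degreeLT r, fun l h _ ↦ ?_⟩
  rw [AlgHom.commutes, Module.algebraMap_end_apply, MvPolynomial.smul_eq_C_mul, sub_self]
  exact zero_mem _

theorem one : IsSymbol (1 : WeylAlgebra R n) 1 0 := by
  simpa using algebraMap (n := n) (1 : R)

theorem pow (ha : IsSymbol a f d) (k : ℕ) : IsSymbol (a ^ k) (f ^ k) (k * d) := by
  induction k with
  | zero => simpa using one
  | succ k ih => rw [pow_succ, pow_succ, add_one_mul]; exact ih.mul ha

theorem X (i : Fin n) : IsSymbol (X i : WeylAlgebra R n) (MvPolynomial.X (.inl i)) 1 := by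
  refine ⟨X_mem_degreeLT _, fun l h _ ↦ ?_⟩
  rw [rep_X, sub_self]
  exact zero_mem _

theorem Y (i : Fin n) : IsSymbol (Y i : WeylAlgebra R n) (MvPolynomial.X (.inr i)) 1 := by
  refine ⟨X_mem_degreeLT _, fun l h hh ↦ ?_⟩
  rw [rep_Y, add_sub_cancel_left]
  exact degreeLT_mono (by omega) (pderiv_mem_degreeLT hh _)

/-- An algebra homomorphism from polynomials whose values on the variables have a symbol of order
one has a symbol on monomials. -/
theorem map_monomial {F : MvPolynomial (Fin n) R →ₐ[R] WeylAlgebra R n}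
    {ι : Fin n → Fin n ⊕ Fin n} (hF : ∀ i, IsSymbol (F (MvPolynomial.X i)) (MvPolynomial.X (ι i)) 1)
    (s : Fin n →₀ ℕ) (c : R) :
    IsSymbol (F (monomial s c)) (rename ι (monomial s c)) s.degree := by
  have h1 : IsSymbol (F (monomial s 1)) (rename ι (monomial s 1)) s.degree := by
    induction s using Finsupp.induction_linear with
    | zero => simpa using one
    | add s t hs ht =>
      rw [← mul_one (1 : R), ← monomial_mul, map_mul, map_mul, map_add]
      exact hs.mul ht
    | single i k =>
      rw [← X_pow_eq_monomial, map_pow, map_pow, rename_X, Finsupp.degree_single]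
      simpa using (hF i).pow k
  have h2 := (algebraMap c).mul h1
  rw [zero_add] at h2
  rw [← mul_one c, ← C_mul_monomial, map_mul, map_mul, rename_C, ← MvPolynomial.algebraMap_eq,
    AlgHom.commutes]
  exact h2

theorem normalOrder_monomial (u : Fin n ⊕ Fin n →₀ ℕ) (c : R) :
    IsSymbol (normalOrder R n (monomial u c)) (monomial u c) u.degree := by
  obtain ⟨s, t, hdeg, h⟩ := exists_monomial_eq_rename_mul_rename (R := R) u
  rw [h, normalOrder_rename_mul_rename, hdeg]
  refine (map_monomial (fun i ↦ ?_) s c).mul (map_monomial (fun i ↦ ?_) t 1)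
  · rw [polyX_X]; exact X i
  · rw [polyY_X]; exact Y i

theorem normalOrder (f : MvPolynomial (Fin n ⊕ Fin n) R) :
    IsSymbol (normalOrder R n f) f f.totalDegree := by
  suffices h : ∀ s ⊆ f.support, IsSymbol
      (WeylAlgebra.normalOrder R n (∑ u ∈ s, monomial u (coeff u f)))
      (∑ u ∈ s, monomial u (coeff u f)) f.totalDegree by
    simpa only [← f.as_sum] using h f.support subset_rfl
  intro s hs
  induction s using Finset.cons_induction with
  | empty => simpa using (algebraMap (n := n) (0 : R)).mono (Nat.zero_le f.totalDegree)
  | cons u s hu ih =>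
    rw [Finset.sum_cons, map_add]
    refine ((normalOrder_monomial u _).mono ?_).add
      (ih fun v hv ↦ hs (Finset.mem_cons_of_mem hv))
    exact le_totalDegree (hs (Finset.mem_cons_self u s))

end IsSymbol

instance [Nontrivial R] : Nontrivial (WeylAlgebra R n) :=
  ⟨0, 1, fun h ↦ by
    have h1 := congrArg (fun a ↦ rep R n a 1) h
    simp at h1⟩

theorem not_mem_degreeLT_totalDegree {f : MvPolynomial σ R} (hf : f ≠ 0) :
    f ∉ degreeLT σ R f.totalDegree := by
  intro h
  obtain ⟨u, hu, hdeg⟩ := Finset.exists_mem_eq_sup f.support (support_nonempty.2 hf)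
    fun s ↦ s.degree
  exact mem_support_iff.1 hu (h u hdeg.le)

instance [IsDomain R] : NoZeroDivisors (WeylAlgebra R n) where
  eq_zero_or_eq_zero_of_mul_eq_zero {a b} hab := by
    by_contra! hne
    have hrep : ∀ c : WeylAlgebra R n, c ≠ 0 → rep R n c 1 ≠ 0 := fun c hc h ↦
      hc (by rw [← normalOrder_rep_one c, h, map_zero])
    have ha := hrep a hne.1
    have hb := hrep b hne.2
    set f := rep R n a 1 with hf
    set g := rep R n b 1 with hg
    have hfa : IsSymbol a f f.totalDegree := by
      simpa only [hf, normalOrder_rep_one] using IsSymbol.normalOrder f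
    have hgb : IsSymbol b g g.totalDegree := by
      simpa only [hg, normalOrder_rep_one] using IsSymbol.normalOrder g
    have h := hfa.2 _ g hgb.1
    rw [hg, ← Module.End.mul_apply, ← map_mul, hab, map_zero, LinearMap.zero_apply, zero_sub,
      neg_mem_iff, ← hg, ← totalDegree_mul_of_isDomain ha hb] at h
    exact not_mem_degreeLT_totalDegree (mul_ne_zero ha hb) h

end Domain

end WeylAlgebra

section TruncWitt

variable (p : ℕ) [Fact p.Prime] (k : Type*) [Field k]

theorem TruncWitt.natCast_pow_eq_zero (m : ℕ) : (p : TruncWitt p k m) ^ m = 0 := by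
  have h : Ideal.Quotient.mk (Ideal.span {(p : WittVector p k) ^ m}) ((p : WittVector p k) ^ m) =
      0 := Ideal.Quotient.eq_zero_iff_mem.2 (Ideal.subset_span rfl)
  rw [map_pow, map_natCast] at h
  exact h

variable [CharP k p]

/-- The residue map of the truncated Witt ring. -/
noncomputable def TruncWitt.residue {m : ℕ} (hm : 0 < m) : TruncWitt p k m →+* k :=
  Ideal.Quotient.lift _ (WittVector.constantCoeff (p := p) (R := k)) fun a ha ↦ by
    obtain ⟨b, rfl⟩ := Ideal.mem_span_singleton.1 ha
    rw [map_mul, map_pow, map_natCast, CharP.cast_eq_zero, zero_pow hm.ne', zero_mul]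

theorem TruncWitt.residue_surjective {m : ℕ} (hm : 0 < m) :
    Function.Surjective (TruncWitt.residue p k hm) :=
  Ideal.Quotient.lift_surjective_of_surjective _ _ fun x ↦
    ⟨WittVector.teichmuller p x, WittVector.teichmuller_coeff_zero p x⟩

theorem TruncWitt.residue_eq_zero_iff [PerfectRing k p] {m : ℕ} (hm : 0 < m)
    (r : TruncWitt p k m) : TruncWitt.residue p k hm r = 0 ↔ (p : TruncWitt p k m) ∣ r := by
  constructor
  · obtain ⟨w, rfl⟩ := Ideal.Quotient.mk_surjective r
    intro h
    obtain ⟨v, rfl⟩ := Ideal.mem_span_singleton.1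
      ((WittVector.mem_span_p_iff_coeff_zero_eq_zero w).2 h)
    refine ⟨Ideal.Quotient.mk _ v, ?_⟩
    rw [map_mul, map_natCast]
    rfl
  · rintro ⟨b, rfl⟩
    rw [map_mul, map_natCast, CharP.cast_eq_zero, zero_mul]

theorem TruncWitt.dvd_of_pow_mul_eq_zero {m : ℕ} [PerfectRing k p] (hm : 0 < m)
    (r : TruncWitt p k m) (hr : (p : TruncWitt p k m) ^ (m - 1) * r = 0) :
    (p : TruncWitt p k m) ∣ r := by
  obtain ⟨w, rfl⟩ := Ideal.Quotient.mk_surjective r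
  have h : Ideal.Quotient.mk (Ideal.span {(p : WittVector p k) ^ m})
      ((p : WittVector p k) ^ (m - 1) * w) = 0 := by
    rw [map_mul, map_pow, map_natCast]
    exact hr
  obtain ⟨v, hv⟩ := Ideal.mem_span_singleton.1 (Ideal.Quotient.eq_zero_iff_mem.1 h)
  obtain ⟨l, rfl⟩ := Nat.exists_eq_succ_of_ne_zero hm.ne'
  rw [Nat.succ_sub_one, Nat.succ_eq_add_one, pow_succ, mul_assoc] at hv
  have hw : w = p * v :=
    mul_left_cancel₀ (pow_ne_zero _ (WittVector.p_nonzero p k)) hv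
  refine ⟨Ideal.Quotient.mk _ v, ?_⟩
  rw [hw, map_mul, map_natCast]
  rfl

end TruncWitt

/-- Let `W` be the Witt ring of an algebraically closed field `k` of characteristic `p`,
`W_m = W/(pᵐ)`, `D_{pᵐ}` the localization of the Weyl algebra `A_n(W_m)` at the
non-zero-divisors, and `D_p` the division ring of fractions of `A_n(k)`.  Then the
associated graded ring of `D_{pᵐ}` for the filtration by powers of `p` is isomorphic to
`D_p[z]/(zᵐ)`: there are additive isomorphisms `eᵢ : pⁱD_{pᵐ}/pⁱ⁺¹D_{pᵐ} ≃ D_p`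
(`i < m`) compatible with multiplication; in particular `D_{pᵐ}` is an Artinian ring. -/
theorem stmt13 (p n m : ℕ) [Fact p.Prime] (hm : 0 < m)
    (k : Type*) [Field k] [IsAlgClosed k] [CharP k p]
    [OreLocalization.OreSet (nonZeroDivisors (WeylAlgebra (TruncWitt p k m) n))]
    [OreLocalization.OreSet (nonZeroDivisors (WeylAlgebra k n))] :
    let D := WeylLoc (TruncWitt p k m) n
    IsArtinianRing D ∧
    ∃ hmul : ∀ (i j : ℕ) (a b : D),
        a ∈ (AddMonoidHom.mulLeft ((p : D) ^ i)).range →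
        b ∈ (AddMonoidHom.mulLeft ((p : D) ^ j)).range →
        a * b ∈ (AddMonoidHom.mulLeft ((p : D) ^ (i + j))).range,
      ∃ e : (i : Fin m) → grPiece D (p : D) i ≃+ WeylLoc k n,
        ∀ (i j : Fin m) (h : (i : ℕ) + (j : ℕ) < m) (a b : D)
          (ha : a ∈ (AddMonoidHom.mulLeft ((p : D) ^ (i : ℕ))).range)
          (hb : b ∈ (AddMonoidHom.mulLeft ((p : D) ^ (j : ℕ))).range),
          e ⟨(i : ℕ) + (j : ℕ), h⟩ (grMk D (p : D) ((i : ℕ) + (j : ℕ)) (a * b)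
              (hmul i j a b ha hb)) =
            e i (grMk D (p : D) i a ha) * e j (grMk D (p : D) j b hb) := by
  have hker := WeylAlgebra.map_eq_zero_iff (n := n) (TruncWitt.residue_eq_zero_iff p k hm)
  have hann : ∀ a : WeylAlgebra (TruncWitt p k m) n, (p : WeylAlgebra (TruncWitt p k m) n) ^ (m - 1)
      * a = 0 → WeylAlgebra.map (TruncWitt.residue p k hm) a = 0 := fun a ha ↦
    (hker a).2 (WeylAlgebra.dvd_of_pow_mul_eq_zero (TruncWitt.dvd_of_pow_mul_eq_zero p k hm) ha)
  have hnil : (p : WeylAlgebra (TruncWitt p k m) n) ^ m = 0 := by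
    rw [← map_natCast (algebraMap (TruncWitt p k m) _), ← map_pow,
      TruncWitt.natCast_pow_eq_zero, map_zero]
  have hreg := mem_nonZeroDivisors_iff_map_ne_zero hm hker hann hnil
  have hreg' : ∀ a, a ∈ nonZeroDivisors (WeylAlgebra (TruncWitt p k m) n) ↔
      WeylAlgebra.map (TruncWitt.residue p k hm) a ∈ nonZeroDivisors (WeylAlgebra k n) :=
    fun a ↦ (hreg a).trans mem_nonZeroDivisors_iff_ne_zero.symm
  have hπ := fun a ↦ (hreg' a).1
  have hsurj := oreMap_surjective hπ (fun a ↦ (hreg' a).2)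
    (WeylAlgebra.map_surjective _ (TruncWitt.residue_surjective p k hm))
  have hker' := oreMap_eq_zero_iff hπ hker
  have hann' := oreMap_eq_zero_of_pow_mul_eq_zero hπ hann
  have hq := fun x : WeylLoc (TruncWitt p k m) n ↦ Nat.cast_commute p x
  exact ⟨isArtinianRing_oreLocalization hker hreg hnil, mul_mem_range_mulLeft_pow hq,
    grPieceEquiv (D := WeylLoc (TruncWitt p k m) n) (E := WeylLoc k n) hsurj hker' hann',
    fun i j h a b ha hb ↦ grPieceEquiv_grMk_mul (D := WeylLoc (TruncWitt p k m) n)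
      (E := WeylLoc k n) hq hsurj hker' hann' i j h a b ha hb _⟩
end

section
/- Let Z be a field of characteristic p, finitely generated over an algebraically closed field F, and let V ⊆ Z ⊗_F U be a Z-subspace of Z ⊗ U for a finite dimensional F-vector space U. If for every m ≥ 1 the subspace V is defined over Z^{p^m} (i.e., V = Z ⊗_{Z^{p^m}} V_m for some Z^{p^m}-subspace V_m of Z^{p^m} ⊗_F U), then V is defined over F, i.e., V = Z ⊗_F V₀ for some F-subspace V₀ ⊆ U. -/
open scoped TensorProduct

/-- A `Z`-subspace `V ⊆ Z ⊗_F U` is defined over a subfield `L ⊆ Z` (with `F ⊆ L`) if `V`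
is spanned over `Z` by its elements lying in (the image of) `L ⊗_F U`, i.e.
`V = Z ⊗_L V_L` for `V_L = V ∩ (L ⊗ U)`. -/
def DefinedOver {F Z U : Type*} [Field F] [Field Z] [Algebra F Z]
    [AddCommGroup U] [Module F U]
    (L : Subfield Z) (V : Submodule Z (Z ⊗[F] U)) : Prop :=
  V = Submodule.span Z ((V : Set (Z ⊗[F] U)) ∩
    (Submodule.span F {y : Z ⊗[F] U | ∃ l ∈ L, ∃ u : U, y = l ⊗ₜ[F] u} : Set (Z ⊗[F] U)))

open scoped IntermediateField.algebraAdjoinAdjoin in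
/-- In a finitely generated field extension, an element with roots of unboundedly large order is
algebraic. -/
theorem isAlgebraic_of_forall_exists_pow_eq {F Z : Type*} [Field F] [Field Z] [Algebra F Z]
    [Algebra.EssFiniteType F Z] {x : Z} (hx : ∀ n : ℕ, ∃ k > n, ∃ y : Z, y ^ k = x) :
    IsAlgebraic F x := by
  by_contra htr
  have hind : AlgebraicIndepOn F id ({x} : Set Z) :=
    (algebraicIndependent_unique_type_iff (ι := ({x} : Set Z))).2 htr
  obtain ⟨t, hxt, ht⟩ := exists_isTranscendenceBasis_superset hind
  let A := Algebra.adjoin F (Set.range ((↑) : t → Z))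
  let K := IntermediateField.adjoin F (Set.range ((↑) : t → Z))
  have : Algebra.IsAlgebraic K Z := ht.isAlgebraic_field
  have : Algebra.EssFiniteType K Z := .of_comp F K Z
  have : Module.Finite K Z := Algebra.finite_of_essFiniteType_of_isAlgebraic
  have : UniqueFactorizationMonoid A :=
    ht.1.aevalEquiv.toMulEquiv.uniqueFactorizationMonoid inferInstance
  let a : A := ht.1.aevalEquiv (MvPolynomial.X ⟨x, hxt rfl⟩)
  have ha : Prime a :=
    (MulEquiv.prime_iff ht.1.aevalEquiv.toMulEquiv).2 (MvPolynomial.X_prime)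
  have hax : algebraMap K Z (algebraMap A K a) = x := by
    change ((ht.1.aevalEquiv (MvPolynomial.X ⟨x, hxt rfl⟩) : A) : Z) = x
    simp
  obtain ⟨k, hk, y, hy⟩ := hx (Module.finrank K Z)
  have hnorm : Algebra.norm K y ^ k = algebraMap A K (a ^ Module.finrank K Z) := by
    rw [← map_pow, hy, ← hax, Algebra.norm_algebraMap, map_pow]
  obtain ⟨q, hq⟩ := IsIntegrallyClosed.exists_algebraMap_eq_of_isIntegral_pow
    (R := A) (K := K) (x := Algebra.norm K y) (n := k) (by lia) (hnorm ▸ isIntegral_algebraMap)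
  rw [← hq, ← map_pow] at hnorm
  have hqa := congrArg (emultiplicity a) (IsFractionRing.injective A K hnorm)
  rw [emultiplicity_pow ha, emultiplicity_pow_self ha.ne_zero ha.not_isUnit] at hqa
  have hpos : 0 < Module.finrank K Z := Module.finrank_pos
  cases h : emultiplicity a q with
  | top => simp [h, ENat.mul_top, show k ≠ 0 by lia] at hqa
  | coe e =>
    rw [h] at hqa
    norm_cast at hqa
    rcases e.eq_zero_or_pos with rfl | he
    · lia
    · nlinarith

/-- A subspace of `Zⁿ` spanned by vectors with coordinates in `L` is stable under applying an
`L`-linear endomorphism of `Z` to every coordinate. -/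
theorem Submodule.comp_mem_of_le_span {Z ι : Type*} [Field Z] {L : Subfield Z}
    {W : Submodule Z (ι → Z)} (hW : W ≤ span Z {w | w ∈ W ∧ ∀ i, w i ∈ L})
    (φ : Z →ₗ[L] Z) {w : ι → Z} (hw : w ∈ W) : φ ∘ w ∈ W := by
  suffices h : ∀ v ∈ span Z {w | w ∈ W ∧ ∀ i, w i ∈ L}, ∀ c : Z, φ ∘ (c • v) ∈ W by
    simpa using h w (hW hw) 1
  intro v hv
  induction hv using span_induction with
  | mem v hv =>
    intro c
    convert W.smul_mem (φ c) hv.1 using 1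
    ext i
    simpa [mul_comm, Subfield.smul_def] using φ.map_smul (⟨v i, hv.2 i⟩ : L) c
  | zero => simp [Function.comp_def, W.zero_mem, ← Pi.zero_def]
  | add u v _ _ hu hv =>
    intro c
    convert W.add_mem (hu c) (hv c) using 1
    ext i
    simp
  | smul d v _ hv =>
    intro c
    rw [smul_smul]
    exact hv _

/-- If a subspace of `Zⁿ` is spanned by vectors over each of the subfields `L m`, then it is
spanned by vectors over their intersection. -/
theorem Submodule.le_span_of_forall_le_span {Z ι κ : Type*} [Field Z] [Finite ι]
    {L : κ → Subfield Z} {W : Submodule Z (ι → Z)}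
    (hW : ∀ m, W ≤ span Z {w | w ∈ W ∧ ∀ i, w i ∈ L m}) :
    W ≤ span Z {w | w ∈ W ∧ ∀ i m, w i ∈ L m} := by
  intro w hw
  induction hs : Function.support w using WellFoundedLT.induction generalizing w with
  | ind s ih =>
  subst hs
  by_cases hmin : ∃ v ∈ W, v ≠ 0 ∧ Function.support v < Function.support w
  · obtain ⟨v, hv, hv0, hlt⟩ := hmin
    obtain ⟨i, hi⟩ := Function.ne_iff.1 hv0
    have hsub : w - (w i / v i) • v ∈ span Z {w | w ∈ W ∧ ∀ i m, w i ∈ L m} := by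
      refine ih _ ?_ (W.sub_mem hw (W.smul_mem _ hv)) rfl
      refine (Set.ssubset_iff_of_subset fun j hj => ?_).2 ⟨i, hlt.le hi, ?_⟩
      · intro hwj
        have hvj : v j = 0 := by_contra fun h => hlt.le h hwj
        simp [hwj, hvj] at hj
      · simp [div_mul_cancel₀ _ hi]
    simpa using add_mem hsub (smul_mem _ (w i / v i) (ih _ hlt hv rfl))
  · push Not at hmin
    rcases eq_or_ne w 0 with rfl | hw0
    · exact zero_mem _
    obtain ⟨i, hi⟩ := Function.ne_iff.1 hw0
    have hmem : (w i)⁻¹ • w ∈ W := W.smul_mem _ hw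
    have hL : ∀ j m, ((w i)⁻¹ • w) j ∈ L m := by
      intro j m
      obtain ⟨f, hf⟩ := (Algebra.linearMap (L m) Z).exists_leftInverse_of_injective
        (LinearMap.ker_eq_bot.2 (algebraMap (L m) Z).injective)
      have hf1 : f 1 = 1 := by simpa using LinearMap.congr_fun hf 1
      let u : ι → Z := (Algebra.linearMap (L m) Z ∘ₗ f) ∘ ((w i)⁻¹ • w) - (w i)⁻¹ • w
      have hu : u = 0 := by
        by_contra hu0
        refine hmin u (W.sub_mem (comp_mem_of_le_span (hW m) _ hmem) hmem) hu0
          ((Set.ssubset_iff_of_subset fun k hk => ?_).2 ⟨i, hi, ?_⟩)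
        · intro hwk
          simp [u, hwk] at hk
        · simp [u, inv_mul_cancel₀ hi, hf1]
      rw [← sub_eq_zero.1 (congrFun hu j)]
      exact (f _).2
    have := smul_mem _ (w i) (subset_span (R := Z) (s := {w | w ∈ W ∧ ∀ i m, w i ∈ L m})
      ⟨hmem, hL⟩)
    rwa [smul_inv_smul₀ hi] at this

open Algebra.TensorProduct in
/-- The elements of `L ⊗ U` are those whose coordinates lie in `L`. -/
theorem mem_span_tmul_iff_repr_mem {F Z U ι : Type*} [Field F] [Field Z] [Algebra F Z]
    [AddCommGroup U] [Module F U] [Finite ι] (b : Module.Basis ι F U) {L : Subfield Z}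
    (hFL : ∀ a, algebraMap F Z a ∈ L) (x : Z ⊗[F] U) :
    x ∈ Submodule.span F {y : Z ⊗[F] U | ∃ l ∈ L, ∃ u : U, y = l ⊗ₜ[F] u} ↔
      ∀ i, (basis Z b).repr x i ∈ L := by
  have := Fintype.ofFinite ι
  constructor
  · intro hx i
    induction hx using Submodule.span_induction with
    | mem x hx =>
      obtain ⟨l, hl, u, rfl⟩ := hx
      simpa [Algebra.smul_def] using L.mul_mem hl (hFL (b.repr u i))
    | zero => simp
    | add x y _ _ hx hy => simpa using L.add_mem hx hy
    | smul a x _ hx =>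
      rw [← algebraMap_smul Z a x, map_smul]
      simpa only [Finsupp.smul_apply, smul_eq_mul] using L.mul_mem (hFL a) hx
  · intro hx
    rw [← (basis Z b).sum_repr x]
    refine Submodule.sum_mem _ fun i _ => Submodule.subset_span ⟨_, hx i, b i, ?_⟩
    simp [TensorProduct.smul_tmul']

open Algebra.TensorProduct in
/-- `DefinedOver` in terms of coordinates with respect to an `F`-basis of `U`. -/
theorem definedOver_iff_le_span {F Z U ι : Type*} [Field F] [Field Z] [Algebra F Z]
    [AddCommGroup U] [Module F U] [Finite ι] (b : Module.Basis ι F U) {L : Subfield Z}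
    (hFL : ∀ a, algebraMap F Z a ∈ L) (V : Submodule Z (Z ⊗[F] U)) :
    DefinedOver L V ↔ V.map (basis Z b).equivFun.toLinearMap ≤
      Submodule.span Z {w | w ∈ V.map (basis Z b).equivFun.toLinearMap ∧ ∀ i, w i ∈ L} := by
  have himage : {w | w ∈ V.map (basis Z b).equivFun.toLinearMap ∧ ∀ i, w i ∈ L} =
      (basis Z b).equivFun.toLinearMap '' ((V : Set (Z ⊗[F] U)) ∩
        (Submodule.span F {y : Z ⊗[F] U | ∃ l ∈ L, ∃ u : U, y = l ⊗ₜ[F] u} :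
          Set (Z ⊗[F] U))) := by
    ext w
    constructor
    · rintro ⟨⟨x, hx, rfl⟩, hw⟩
      exact ⟨x, ⟨hx, (mem_span_tmul_iff_repr_mem b hFL x).2 hw⟩, rfl⟩
    · rintro ⟨x, ⟨hx, hxL⟩, rfl⟩
      exact ⟨⟨x, hx, rfl⟩, (mem_span_tmul_iff_repr_mem b hFL x).1 hxL⟩
  rw [himage, ← Submodule.map_span,
    Submodule.map_le_map_iff_of_injective (basis Z b).equivFun.injective]
  exact ⟨fun h => h.le, fun h => le_antisymm h
    (Submodule.span_le.2 Set.inter_subset_left)⟩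

/-- Lemma (Plucker), descent direction: let `Z` be a finitely generated extension of an
algebraically closed field `F` of characteristic `p`, `U` a finite dimensional `F`-vector
space, and `V ⊆ Z ⊗_F U` a `Z`-subspace.  If for every `m ≥ 1` the subspace `V` is defined
over the subfield `Z^{pᵐ}` of `pᵐ`-th powers, then `V` is defined over `F`.
(Uses `⋂ₘ Z^{pᵐ} = F`.) -/
theorem stmt19 (F Z : Type*) [Field F] [Field Z] [Algebra F Z] [IsAlgClosed F]
    (p : ℕ) [Fact p.Prime] [CharP Z p]
    (hfg : ∃ s : Finset Z, IntermediateField.adjoin F (s : Set Z) = ⊤)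
    (U : Type*) [AddCommGroup U] [Module F U] [FiniteDimensional F U]
    (V : Submodule Z (Z ⊗[F] U))
    (hdef : ∀ m : ℕ, 1 ≤ m → DefinedOver ((iterateFrobenius Z p m).fieldRange) V) :
    DefinedOver (algebraMap F Z).fieldRange V := by
  have : Algebra.EssFiniteType F Z := IntermediateField.fg_top_iff.1 hfg
  have hp : 1 < p := (Fact.out : p.Prime).one_lt
  let b := Module.finBasis F U
  have hF : ∀ (m : ℕ) (a : F), algebraMap F Z a ∈ (iterateFrobenius Z p m).fieldRange := by
    intro m a
    obtain ⟨c, rfl⟩ := IsAlgClosed.exists_pow_nat_eq a (pow_pos (zero_lt_one.trans hp) m)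
    exact ⟨algebraMap F Z c, by simp [iterateFrobenius_def]⟩
  refine (definedOver_iff_le_span b (algebraMap F Z).mem_fieldRange_self V).2 ?_
  refine (Submodule.le_span_of_forall_le_span
    (L := fun m : ℕ => (iterateFrobenius Z p (m + 1)).fieldRange) fun m =>
      (definedOver_iff_le_span b (hF _) V).1 (hdef _ m.succ_pos)).trans
    (Submodule.span_mono fun w hw => ⟨hw.1, fun i => ?_⟩)
  have halg : IsAlgebraic F (w i) := isAlgebraic_of_forall_exists_pow_eq fun n => by
    obtain ⟨y, hy⟩ := hw.2 i n
    exact ⟨p ^ (n + 1), n.lt_succ_self.trans (Nat.lt_pow_self hp), y, hy⟩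
  exact minpoly.mem_range_of_degree_eq_one F (w i)
    (IsAlgClosed.degree_eq_one_of_irreducible F (minpoly.irreducible halg.isIntegral))
end
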